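/- arXiv:2309.17381 — 4 statements merged into one kernel-verified Lean document; each statement's English description precedes it below -/
import Mathlib

section
/- The permutation action of the symmetric group S_8 on the 8-element set Λ induces F_2-linear automorphisms of E_3 preserving the symplectic pairing; the resulting group homomorphism S_8 → Sp(6,2) is injective, and its image has index exactly 36 in Sp(6,2). -/
open Finset

noncomputable section

/-- The ambient 8-dimensional vector space over `𝔽₂`, coordinates indexed by the 8 labels. -/
abbrev W8 : Type := Fin 8 → ZMod 2

/-- The sum-of-coordinates linear functional on `W8`. -/
def sumForm : W8 →ₗ[ZMod 2] ZMod 2 where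
  toFun f := ∑ i, f i
  map_add' f g := by simp [Finset.sum_add_distrib]
  map_smul' c f := by simp [Finset.mul_sum]

/-- The even-weight subspace (corresponding to even-cardinality subsets). -/
def V8 : Submodule (ZMod 2) W8 := LinearMap.ker sumForm

lemma mem_V8 {f : W8} : f ∈ V8 ↔ (∑ i, f i) = 0 := LinearMap.mem_ker

/-- The all-ones vector (the indicator of the full label set `Λ`). -/
def oneW : W8 := fun _ => 1

lemma oneW_mem : oneW ∈ V8 := mem_V8.mpr (by decide)

def oneV : V8 := ⟨oneW, oneW_mem⟩

/-- The line spanned by the all-ones vector. -/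
def U8 : Submodule (ZMod 2) V8 := Submodule.span (ZMod 2) {oneV}

/-- `E₃`: even-cardinality subsets of an 8-element set modulo complement, as an
`𝔽₂`-vector space. -/
abbrev E3 : Type := V8 ⧸ U8

/-- The indicator vector of a subset of the labels. -/
def indV (s : Finset (Fin 8)) : W8 := fun i => if i ∈ s then 1 else 0

lemma indV_mem (s : Finset (Fin 8)) (hs : Even s.card) : indV s ∈ V8 := by
  apply mem_V8.mpr
  have h1 : (∑ i, indV s i) = (s.card : ZMod 2) := by
    simp only [indV]
    rw [Finset.sum_ite_mem, Finset.univ_inter, Finset.sum_const, nsmul_eq_mul, mul_one]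
  rw [h1]
  obtain ⟨k, hk⟩ := hs
  rw [hk]
  push_cast
  rw [← two_mul, show (2 : ZMod 2) = 0 by decide, zero_mul]

/-- The class in `E₃` of an even-cardinality subset of the 8-element set. -/
def toE3 (s : Finset (Fin 8)) (hs : Even s.card) : E3 :=
  Submodule.Quotient.mk ⟨indV s, indV_mem s hs⟩

/-- The standard bilinear form on `W8`. -/
def dotW : W8 →ₗ[ZMod 2] W8 →ₗ[ZMod 2] ZMod 2 :=
  LinearMap.mk₂ (ZMod 2) (fun f g => ∑ i, f i * g i)
    (fun f f' g => by simp [add_mul, Finset.sum_add_distrib])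
    (fun c f g => by simp [smul_eq_mul, Finset.mul_sum, mul_assoc])
    (fun f g g' => by simp [mul_add, Finset.sum_add_distrib])
    (fun c f g => by simp [smul_eq_mul, Finset.mul_sum, mul_left_comm])

def dotV : V8 →ₗ[ZMod 2] V8 →ₗ[ZMod 2] ZMod 2 :=
  LinearMap.compl₁₂ dotW V8.subtype V8.subtype

lemma dotV_apply (f g : V8) : dotV f g = ∑ i, f.1 i * g.1 i := rfl

lemma dotV_one_right (f : V8) : dotV f oneV = 0 := by
  have hf : (∑ i, f.1 i) = 0 := mem_V8.mp f.2
  rw [dotV_apply]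
  simpa [oneV, oneW] using hf

lemma dotV_one_left (f : V8) : dotV oneV f = 0 := by
  have hf : (∑ i, f.1 i) = 0 := mem_V8.mp f.2
  rw [dotV_apply]
  simpa [oneV, oneW] using hf

lemma dotV_ker_right (f : V8) : U8 ≤ LinearMap.ker (dotV f) := by
  show Submodule.span (ZMod 2) {oneV} ≤ _
  rw [Submodule.span_singleton_le_iff_mem, LinearMap.mem_ker]
  exact dotV_one_right f

def pairAux : V8 →ₗ[ZMod 2] (E3 →ₗ[ZMod 2] ZMod 2) where
  toFun f := Submodule.liftQ U8 (dotV f) (dotV_ker_right f)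
  map_add' f g := by
    apply LinearMap.ext
    intro x
    obtain ⟨y, rfl⟩ := Submodule.Quotient.mk_surjective U8 x
    simp [Submodule.liftQ_apply, map_add]
  map_smul' c f := by
    apply LinearMap.ext
    intro x
    obtain ⟨y, rfl⟩ := Submodule.Quotient.mk_surjective U8 x
    simp [Submodule.liftQ_apply, map_smul]

lemma pairAux_ker : U8 ≤ LinearMap.ker pairAux := by
  show Submodule.span (ZMod 2) {oneV} ≤ _
  rw [Submodule.span_singleton_le_iff_mem, LinearMap.mem_ker]
  apply LinearMap.ext
  intro x
  obtain ⟨y, rfl⟩ := Submodule.Quotient.mk_surjective U8 x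
  show dotV oneV y = 0
  exact dotV_one_left y

/-- The symplectic pairing `⟨I, J⟩ = |I ∩ J| mod 2` on `E₃`. -/
def pairing : E3 →ₗ[ZMod 2] E3 →ₗ[ZMod 2] ZMod 2 :=
  Submodule.liftQ U8 pairAux pairAux_ker

/-- The linear action of a permutation of the labels on `W8`. -/
def permW (σ : Equiv.Perm (Fin 8)) : W8 →ₗ[ZMod 2] W8 where
  toFun f := fun i => f (σ.symm i)
  map_add' f g := rfl
  map_smul' c f := rfl

lemma permW_mapsTo (σ : Equiv.Perm (Fin 8)) : ∀ x ∈ V8, permW σ x ∈ V8 := by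
  intro x hx
  apply mem_V8.mpr
  have hx' : (∑ i, x i) = 0 := mem_V8.mp hx
  have h : (∑ i, permW σ x i) = ∑ i, x (σ.symm i) := rfl
  rw [h, Equiv.sum_comp σ.symm x]
  exact hx'

def permV (σ : Equiv.Perm (Fin 8)) : V8 →ₗ[ZMod 2] V8 :=
  (permW σ).restrict (permW_mapsTo σ)

lemma permV_one (σ : Equiv.Perm (Fin 8)) : permV σ oneV = oneV := Subtype.ext rfl

lemma permV_comap (σ : Equiv.Perm (Fin 8)) : U8 ≤ U8.comap (permV σ) := by
  show Submodule.span (ZMod 2) {oneV} ≤ _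
  rw [Submodule.span_singleton_le_iff_mem, Submodule.mem_comap, permV_one]
  exact Submodule.mem_span_singleton_self oneV

/-- The induced action of a permutation of the labels on `E₃`. -/
def permE3 (σ : Equiv.Perm (Fin 8)) : E3 →ₗ[ZMod 2] E3 :=
  Submodule.mapQ U8 U8 (permV σ) (permV_comap σ)

/-- `Sp(6,2)`: the group of linear automorphisms of `E₃` preserving the symplectic pairing. -/
def Sp6 : Subgroup (E3 ≃ₗ[ZMod 2] E3) where
  carrier := {g | ∀ x y : E3, pairing (g x) (g y) = pairing x y}
  one_mem' := fun _ _ => rfl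
  mul_mem' := by
    intro a b ha hb x y
    show pairing (a (b x)) (a (b y)) = pairing x y
    rw [ha (b x) (b y), hb x y]
  inv_mem' := by
    intro a ha x y
    show pairing (a.symm x) (a.symm y) = pairing x y
    calc pairing (a.symm x) (a.symm y)
        = pairing (a (a.symm x)) (a (a.symm y)) := (ha _ _).symm
      _ = pairing x y := by rw [a.apply_symm_apply, a.apply_symm_apply]

lemma pairing_mk (f g : V8) :
    pairing (Submodule.Quotient.mk f) (Submodule.Quotient.mk g) = ∑ i, f.1 i * g.1 i := rfl

lemma pairing_symm (x y : E3) : pairing x y = pairing y x := by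
  obtain ⟨f, rfl⟩ := Submodule.Quotient.mk_surjective U8 x
  obtain ⟨g, rfl⟩ := Submodule.Quotient.mk_surjective U8 y
  simp only [pairing_mk, mul_comm]

lemma zmod2_mul_self (a : ZMod 2) : a * a = a := by revert a; decide

lemma zmod2_cases (a : ZMod 2) : a = 0 ∨ a = 1 := by revert a; decide

lemma pairing_self (x : E3) : pairing x x = 0 := by
  obtain ⟨f, rfl⟩ := Submodule.Quotient.mk_surjective U8 x
  simp only [pairing_mk, zmod2_mul_self]
  exact mem_V8.mp f.2

lemma indV_pair (i j : Fin 8) (h : i ≠ j) : Even ({i, j} : Finset (Fin 8)).card := by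
  rw [Finset.card_pair h]; exact even_two

lemma pairing_nondeg (x : E3) (h : ∀ y, pairing x y = 0) : x = 0 := by
  obtain ⟨f, rfl⟩ := Submodule.Quotient.mk_surjective U8 x
  have hc : ∀ i, f.1 i = f.1 0 := by
    intro i
    by_cases hi : i = 0
    · rw [hi]
    have h1 := h (toE3 {i, 0} (indV_pair i 0 hi))
    rw [toE3, pairing_mk] at h1
    simp only [indV, mul_ite, mul_one, mul_zero] at h1
    rw [Finset.sum_ite_mem, Finset.univ_inter, Finset.sum_pair hi] at h1
    exact CharTwo.add_eq_zero.mp h1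
  rw [Submodule.Quotient.mk_eq_zero]
  refine Submodule.mem_span_singleton.mpr ⟨f.1 0, ?_⟩
  apply Subtype.ext
  funext i
  rw [hc i]
  simp [oneV, oneW]

lemma exists_pairing_one (x : E3) (hx : x ≠ 0) : ∃ y, pairing x y = 1 := by
  by_contra hcon
  push Not at hcon
  exact hx (pairing_nondeg x fun y => (zmod2_cases _).resolve_right (hcon y))

lemma finrank_E3 : Module.finrank (ZMod 2) E3 = 6 := by
  have h1 : Module.finrank (ZMod 2) V8 = 7 := by
    have h := LinearMap.finrank_range_add_finrank_ker sumForm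
    have hs : Function.Surjective sumForm := by
      intro c
      refine ⟨Pi.single 0 c, ?_⟩
      simp [sumForm]
    rw [LinearMap.range_eq_top.mpr hs, finrank_top] at h
    simp only [Module.finrank_self, Module.finrank_fintype_fun_eq_card, Fintype.card_fin] at h
    change 1 + Module.finrank (ZMod 2) V8 = 8 at h
    omega
  have h2 : Module.finrank (ZMod 2) U8 = 1 := by
    apply finrank_span_singleton
    intro h
    have := congrFun (congrArg Subtype.val h) 0
    simp [oneV, oneW] at this
  have h3 := Submodule.finrank_quotient_add_finrank U8
  rw [h1, h2] at h3
  exact Nat.succ_injective h3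

instance finite_E3 : Finite E3 := Module.finite_of_finite (ZMod 2)

/-- The map given by pairing against a family. -/
def pairMap {k : ℕ} (v : Fin k → E3) : E3 →ₗ[ZMod 2] (Fin k → ZMod 2) :=
  LinearMap.pi fun i => pairing (v i)

lemma pairMap_surj {k : ℕ} (v w : Fin k → E3)
    (h : ∀ i j, pairing (v i) (w j) = if i = j then 1 else 0) :
    Function.Surjective (pairMap v) := by
  intro c
  refine ⟨∑ j, c j • w j, ?_⟩
  funext i
  simp [pairMap, h]

lemma fiber_card {k : ℕ} (v w : Fin k → E3) (c : Fin k → ZMod 2)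
    (h : ∀ i j, pairing (v i) (w j) = if i = j then 1 else 0) :
    Nat.card {x : E3 // ∀ i, pairing (v i) x = c i} = 2 ^ (6 - k) := by
  have hs := pairMap_surj v w h
  obtain ⟨x0, hx0⟩ := hs c
  have hx0' : ∀ i, pairing (v i) x0 = c i := fun i => congrFun hx0 i
  have e : {x : E3 // ∀ i, pairing (v i) x = c i} ≃ LinearMap.ker (pairMap v) :=
    { toFun := fun x => ⟨x.1 - x0, by
        rw [LinearMap.mem_ker]; funext i
        simp [pairMap, x.2 i, hx0' i]⟩
      invFun := fun y => ⟨y.1 + x0, fun i => by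
        have : pairing (v i) y.1 = 0 := congrFun (LinearMap.mem_ker.mp y.2) i
        rw [map_add, this, hx0', zero_add]⟩
      left_inv := fun x => by simp
      right_inv := fun y => by simp }
  rw [Nat.card_congr e, Module.natCard_eq_pow_finrank (K := ZMod 2)]
  have hr := LinearMap.finrank_range_add_finrank_ker (pairMap v)
  rw [LinearMap.range_eq_top.mpr hs, finrank_top, finrank_E3] at hr
  simp only [Module.finrank_fintype_fun_eq_card, Fintype.card_fin] at hr
  rw [Nat.card_zmod]
  congr 1
  omega

lemma card_ne_zero_and (P : E3 → Prop) (h0 : P 0) (n : ℕ) (h : Nat.card {x // P x} = n + 1) :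
    Nat.card {x : E3 // P x ∧ x ≠ 0} = n := by
  have h1 : Nat.card {x : E3 // P x ∧ x ≠ 0} = ({x | P x} \ {0} : Set E3).ncard := rfl
  have h2 : Nat.card {x // P x} = ({x | P x} : Set E3).ncard := rfl
  rw [h1, Set.ncard_sdiff_singleton_of_mem (by exact h0), ← h2, h]
  rfl

lemma card_step {α β : Type} [Finite α] [Finite β] (P : α → Prop) (Q : α → β → Prop) (a b : ℕ)
    (hP : Nat.card {x // P x} = a) (hQ : ∀ x, P x → Nat.card {y // Q x y} = b) :
    Nat.card {p : α × β // P p.1 ∧ Q p.1 p.2} = a * b := by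
  have e : {p : α × β // P p.1 ∧ Q p.1 p.2} ≃ Σ x : {x // P x}, {y // Q x.1 y} :=
    { toFun := fun p => ⟨⟨p.1.1, p.2.1⟩, ⟨p.1.2, p.2.2⟩⟩
      invFun := fun s => ⟨(s.1.1, s.2.1), s.1.2, s.2.2⟩
      left_inv := fun _ => rfl
      right_inv := fun _ => rfl }
  classical
  have := Fintype.ofFinite α
  rw [Nat.card_congr e, Nat.card_sigma, Finset.sum_congr rfl (fun x _ => hQ x.1 x.2),
    Finset.sum_const, smul_eq_mul, Finset.card_univ, ← Nat.card_eq_fintype_card, hP]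

/-- Conditions for the successive vectors of a symplectic basis. -/
def Q1 (e1 : E3) : Prop := True ∧ e1 ≠ 0
def Q2 (p : E3) (f : E3) : Prop := pairing p f = 1
def Q3 (p : E3 × E3) (x : E3) : Prop :=
  (pairing p.1 x = 0 ∧ pairing p.2 x = 0) ∧ x ≠ 0
def Q4 (p : (E3 × E3) × E3) (x : E3) : Prop :=
  pairing p.1.1 x = 0 ∧ pairing p.1.2 x = 0 ∧ pairing p.2 x = 1
def Q5 (p : ((E3 × E3) × E3) × E3) (x : E3) : Prop :=
  (pairing p.1.1.1 x = 0 ∧ pairing p.1.1.2 x = 0 ∧ pairing p.1.2 x = 0 ∧ pairing p.2 x = 0) ∧ x ≠ 0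
def Q6 (p : (((E3 × E3) × E3) × E3) × E3) (x : E3) : Prop :=
  pairing p.1.1.1.1 x = 0 ∧ pairing p.1.1.1.2 x = 0 ∧ pairing p.1.1.2 x = 0 ∧
    pairing p.1.2 x = 0 ∧ pairing p.2 x = 1

def P2 (p : E3 × E3) : Prop := Q1 p.1 ∧ Q2 p.1 p.2
def P3 (p : (E3 × E3) × E3) : Prop := P2 p.1 ∧ Q3 p.1 p.2
def P4 (p : ((E3 × E3) × E3) × E3) : Prop := P3 p.1 ∧ Q4 p.1 p.2
def P5 (p : (((E3 × E3) × E3) × E3) × E3) : Prop := P4 p.1 ∧ Q5 p.1 p.2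
def P6 (p : ((((E3 × E3) × E3) × E3) × E3) × E3) : Prop := P5 p.1 ∧ Q6 p.1 p.2

lemma card_Q1 : Nat.card {x // Q1 x} = 63 := by
  apply card_ne_zero_and (fun _ => True) trivial
  have := fiber_card (k := 0) ![] ![] ![] (fun i => i.elim0)
  refine (Nat.card_congr (Equiv.subtypeEquivRight fun x => ?_)).trans this
  simp

lemma card_P2 : Nat.card {x // P2 x} = 63 * 32 := by
  apply card_step Q1 Q2 _ _ card_Q1
  rintro e1 ⟨-, h⟩
  obtain ⟨w, hw⟩ := exists_pairing_one e1 h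
  have := fiber_card (k := 1) ![e1] ![w] ![1] (by simp [Fin.forall_fin_succ, hw])
  refine (Nat.card_congr (Equiv.subtypeEquivRight fun x => ?_)).trans this
  simp [Q2]

lemma card_P3 : Nat.card {x // P3 x} = 63 * 32 * 15 := by
  apply card_step P2 Q3 _ _ card_P2
  rintro ⟨e1, f1⟩ ⟨-, h⟩
  simp only [Q2] at h
  have h' := pairing_symm f1 e1
  rw [h] at h'
  have := fiber_card (k := 2) ![e1, f1] ![f1, e1] ![0, 0]
    (by simp [Fin.forall_fin_succ, h, h', pairing_self])
  apply card_ne_zero_and _ (by simp)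
  refine (Nat.card_congr (Equiv.subtypeEquivRight fun x => ?_)).trans this
  simp [Fin.forall_fin_succ]

lemma card_P4 : Nat.card {x // P4 x} = 63 * 32 * 15 * 8 := by
  apply card_step P3 Q4 _ _ card_P3
  rintro ⟨⟨e1, f1⟩, e2⟩ ⟨⟨-, h⟩, ⟨h1, h2⟩, h3⟩
  simp only [Q2] at h h1 h2 h3
  have h' := pairing_symm f1 e1
  have h1' := pairing_symm e2 e1
  have h2' := pairing_symm e2 f1
  rw [h] at h'
  rw [h1] at h1'
  rw [h2] at h2'
  obtain ⟨u, hu⟩ := exists_pairing_one e2 h3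
  have := fiber_card (k := 3) ![e1, f1, e2]
    ![f1, e1, u - pairing e1 u • f1 - pairing f1 u • e1] ![0, 0, 1]
    (by simp [Fin.forall_fin_succ, h, h', h1, h2, h1', h2', hu, pairing_self])
  refine (Nat.card_congr (Equiv.subtypeEquivRight fun x => ?_)).trans this
  simp [Q4, Fin.forall_fin_succ]

lemma card_P5 : Nat.card {x // P5 x} = 63 * 32 * 15 * 8 * 3 := by
  apply card_step P4 Q5 _ _ card_P4
  rintro ⟨⟨⟨e1, f1⟩, e2⟩, f2⟩ ⟨⟨⟨-, h⟩, ⟨h1, h2⟩, h3⟩, h4, h5, h6⟩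
  simp only [Q2] at h h1 h2 h3 h4 h5 h6
  have h' := (pairing_symm f1 e1).trans h
  have h1' := (pairing_symm e2 e1).trans h1
  have h2' := (pairing_symm e2 f1).trans h2
  have h4' := (pairing_symm f2 e1).trans h4
  have h5' := (pairing_symm f2 f1).trans h5
  have h6' := (pairing_symm f2 e2).trans h6
  have := fiber_card (k := 4) ![e1, f1, e2, f2] ![f1, e1, f2, e2] ![0, 0, 0, 0]
    (by simp [Fin.forall_fin_succ, h, h', h1, h2, h1', h2', h4, h5, h6, h4', h5', h6',
          pairing_self])
  apply card_ne_zero_and _ (by simp)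
  refine (Nat.card_congr (Equiv.subtypeEquivRight fun x => ?_)).trans this
  simp [Fin.forall_fin_succ]

lemma card_P6 : Nat.card {x // P6 x} = 63 * 32 * 15 * 8 * 3 * 2 := by
  apply card_step P5 Q6 _ _ card_P5
  rintro ⟨⟨⟨⟨e1, f1⟩, e2⟩, f2⟩, e3⟩ ⟨⟨⟨⟨-, h⟩, ⟨h1, h2⟩, h3⟩, h4, h5, h6⟩, ⟨h7, h8, h9, h10⟩, h11⟩
  simp only [Q2] at h h1 h2 h3 h4 h5 h6 h7 h8 h9 h10 h11
  have h' := (pairing_symm f1 e1).trans h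
  have h1' := (pairing_symm e2 e1).trans h1
  have h2' := (pairing_symm e2 f1).trans h2
  have h4' := (pairing_symm f2 e1).trans h4
  have h5' := (pairing_symm f2 f1).trans h5
  have h6' := (pairing_symm f2 e2).trans h6
  have h7' := (pairing_symm e3 e1).trans h7
  have h8' := (pairing_symm e3 f1).trans h8
  have h9' := (pairing_symm e3 e2).trans h9
  have h10' := (pairing_symm e3 f2).trans h10
  obtain ⟨u, hu⟩ := exists_pairing_one e3 h11
  have := fiber_card (k := 5) ![e1, f1, e2, f2, e3]
    ![f1, e1, f2, e2, u - pairing e1 u • f1 - pairing f1 u • e1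
        - pairing e2 u • f2 - pairing f2 u • e2] ![0, 0, 0, 0, 1]
    (by simp [Fin.forall_fin_succ, h, h', h1, h2, h1', h2', h4, h5, h6, h4', h5', h6',
          h7, h8, h9, h10, h7', h8', h9', h10', hu, pairing_self])
  refine (Nat.card_congr (Equiv.subtypeEquivRight fun x => ?_)).trans this
  simp [Q6, Fin.forall_fin_succ]

/-- Families indexed so that consecutive vectors form hyperbolic pairs. -/
def swp : Fin 6 → Fin 6 := ![1, 0, 3, 2, 5, 4]

def IsSymp (v : Fin 6 → E3) : Prop :=
  ∀ i j, pairing (v i) (v j) = if swp i = j then 1 else 0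

def toFam (p : ((((E3 × E3) × E3) × E3) × E3) × E3) : Fin 6 → E3 :=
  ![p.1.1.1.1.1, p.1.1.1.1.2, p.1.1.1.2, p.1.1.2, p.1.2, p.2]

lemma toFam_symp (p) (hp : P6 p) : IsSymp (toFam p) := by
  obtain ⟨⟨⟨⟨⟨e1, f1⟩, e2⟩, f2⟩, e3⟩, f3⟩ := p
  obtain ⟨⟨⟨⟨⟨-, h⟩, ⟨h1, h2⟩, h3⟩, h4, h5, h6⟩, ⟨h7, h8, h9, h10⟩, h11⟩, g1, g2, g3, g4, g5⟩ := hp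
  simp only [Q2] at h h1 h2 h3 h4 h5 h6 h7 h8 h9 h10 h11 g1 g2 g3 g4 g5
  have h' := (pairing_symm f1 e1).trans h
  have h1' := (pairing_symm e2 e1).trans h1
  have h2' := (pairing_symm e2 f1).trans h2
  have h4' := (pairing_symm f2 e1).trans h4
  have h5' := (pairing_symm f2 f1).trans h5
  have h6' := (pairing_symm f2 e2).trans h6
  have h7' := (pairing_symm e3 e1).trans h7
  have h8' := (pairing_symm e3 f1).trans h8
  have h9' := (pairing_symm e3 e2).trans h9
  have h10' := (pairing_symm e3 f2).trans h10
  have g1' := (pairing_symm f3 e1).trans g1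
  have g2' := (pairing_symm f3 f1).trans g2
  have g3' := (pairing_symm f3 e2).trans g3
  have g4' := (pairing_symm f3 f2).trans g4
  have g5' := (pairing_symm f3 e3).trans g5
  intro i j
  fin_cases i <;> fin_cases j <;>
    simp [toFam, swp, h, h', h1, h2, h1', h2', h4, h5, h6, h4', h5', h6',
          h7, h8, h9, h10, h7', h8', h9', h10', g1, g2, g3, g4, g5, g1', g2', g3', g4', g5',
          pairing_self]

lemma swp_swp (i : Fin 6) : swp (swp i) = i := by revert i; decide

/-- A symplectic family is determined by, and expands, all vectors. -/
lemma symp_expand (v : Fin 6 → E3) (hv : IsSymp v) (x : E3) :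
    x = ∑ i, pairing (v (swp i)) x • v i := by
  have hd : ∀ i j, pairing (v i) (v (swp j)) = if i = j then 1 else 0 := by
    intro i j
    rw [hv]
    congr 1
    exact propext ⟨fun h => by rw [← swp_swp i, h, swp_swp], fun h => by rw [h]⟩
  have hc := fiber_card v (fun j => v (swp j)) (fun i => pairing (v i) x) hd
  rw [Nat.sub_self, pow_zero, Nat.card_eq_one_iff_unique] at hc
  have hsub := hc.1
  have := hsub.elim ⟨x, fun _ => rfl⟩ ⟨∑ i, pairing (v (swp i)) x • v i, fun i => by
    have hv' : ∀ j, pairing (v i) (v j) = if swp i = j then 1 else 0 := hv i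
    simp [hv', swp_swp]⟩
  exact congrArg Subtype.val this

/-- The linear map carrying one symplectic family to another. -/
def carry (u v : Fin 6 → E3) : E3 →ₗ[ZMod 2] E3 :=
  ∑ i, (pairing (u (swp i))).smulRight (v i)

lemma carry_apply (u v : Fin 6 → E3) (x : E3) :
    carry u v x = ∑ i, pairing (u (swp i)) x • v i := by
  simp [carry]

lemma carry_fam (u v : Fin 6 → E3) (hu : IsSymp u) (i : Fin 6) : carry u v (u i) = v i := by
  rw [carry_apply]
  have : ∀ j, pairing (u (swp j)) (u i) = if j = i then 1 else 0 := by
    intro j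
    rw [hu, swp_swp]
  simp [this]

lemma carry_pairing (u v : Fin 6 → E3) (hu : IsSymp u) (hv : IsSymp v) (x y : E3) :
    pairing (carry u v x) (carry u v y) = pairing x y := by
  have key : ∀ w : Fin 6 → E3, IsSymp w → ∀ a b : Fin 6 → ZMod 2,
      pairing (∑ i, a i • w i) (∑ i, b i • w i) = ∑ i, a i * b (swp i) := by
    intro w hw a b
    have hw' : ∀ i j, pairing (w i) (w j) = if swp i = j then 1 else 0 := hw
    simp [map_sum, LinearMap.sum_apply, hw']
    simp only [Finset.mul_sum]
    rw [Finset.sum_comm]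
    simp [mul_comm]
  rw [carry_apply, carry_apply, key v hv]
  conv_rhs => rw [symp_expand u hu x, symp_expand u hu y, key u hu]

lemma carry_inj (u v : Fin 6 → E3) (hu : IsSymp u) (hv : IsSymp v) :
    Function.Injective (carry u v) := by
  rw [injective_iff_map_eq_zero]
  intro x hx
  apply pairing_nondeg
  intro y
  rw [← carry_pairing u v hu hv, hx, map_zero, LinearMap.zero_apply]

def carryEquiv (u v : Fin 6 → E3) (hu : IsSymp u) (hv : IsSymp v) : Sp6 :=
  ⟨LinearEquiv.ofBijective (carry u v)
    ⟨carry_inj u v hu hv, Finite.surjective_of_injective (carry_inj u v hu hv)⟩,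
    fun x y => carry_pairing u v hu hv x y⟩

lemma toFam_inj : Function.Injective toFam := by
  rintro ⟨⟨⟨⟨⟨e1, f1⟩, e2⟩, f2⟩, e3⟩, f3⟩ ⟨⟨⟨⟨⟨e1', f1'⟩, e2'⟩, f2'⟩, e3'⟩, f3'⟩ h
  have h0 : e1 = e1' := congrFun h 0
  have h1 : f1 = f1' := congrFun h 1
  have h2 : e2 = e2' := congrFun h 2
  have h3 : f2 = f2' := congrFun h 3
  have h4 : e3 = e3' := congrFun h 4
  have h5 : f3 = f3' := congrFun h 5
  subst h0 h1 h2 h3 h4 h5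
  rfl

lemma card_Sp6 : Nat.card Sp6 = 63 * 32 * 15 * 8 * 3 * 2 := by
  rw [← card_P6]
  have hne : Nonempty {x // P6 x} := by
    have : Nat.card {x // P6 x} ≠ 0 := by rw [card_P6]; norm_num
    exact (Nat.card_ne_zero.mp this).1
  obtain ⟨⟨p0, hp0⟩⟩ := hne
  have hu := toFam_symp p0 hp0
  symm
  apply Nat.card_eq_of_bijective
    (fun p : {x // P6 x} => carryEquiv (toFam p0) (toFam p.1) hu (toFam_symp p.1 p.2))
  constructor
  · intro p q hpq
    apply Subtype.ext
    apply toFam_inj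
    funext i
    have h := congrArg (fun g : Sp6 => g.1 (toFam p0 i)) hpq
    change carry (toFam p0) (toFam p.1) (toFam p0 i) =
      carry (toFam p0) (toFam q.1) (toFam p0 i) at h
    rwa [carry_fam _ _ hu, carry_fam _ _ hu] at h
  · rintro ⟨g, hg⟩
    have hg' : ∀ x y, pairing (g x) (g y) = pairing x y := hg
    obtain ⟨⟨⟨⟨⟨e1, f1⟩, e2⟩, f2⟩, e3⟩, f3⟩ := p0
    refine ⟨⟨⟨⟨⟨⟨⟨g e1, g f1⟩, g e2⟩, g f2⟩, g e3⟩, g f3⟩, ?_⟩, ?_⟩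
    · simpa [P6, P5, P4, P3, P2, Q1, Q2, Q3, Q4, Q5, Q6, hg'] using hp0
    · apply Subtype.ext
      apply LinearEquiv.ext
      intro x
      change carry _ _ x = g x
      have hx := congrArg g (symp_expand _ hu x)
      refine Eq.trans ?_ hx.symm
      rw [carry_apply]
      refine Eq.trans ?_ (map_sum g _ _).symm
      apply Finset.sum_congr rfl
      intro i _
      refine Eq.trans ?_ (LinearEquiv.map_smul g _ _).symm
      congr 1
      fin_cases i <;> rfl

lemma permE3_mul (σ τ : Equiv.Perm (Fin 8)) (x : E3) :
    permE3 (σ * τ) x = permE3 σ (permE3 τ x) := by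
  obtain ⟨f, rfl⟩ := Submodule.Quotient.mk_surjective U8 x
  rfl

lemma permE3_one (x : E3) : permE3 1 x = x := by
  obtain ⟨f, rfl⟩ := Submodule.Quotient.mk_surjective U8 x
  rfl

lemma permE3_pairing (σ : Equiv.Perm (Fin 8)) (x y : E3) :
    pairing (permE3 σ x) (permE3 σ y) = pairing x y := by
  obtain ⟨f, rfl⟩ := Submodule.Quotient.mk_surjective U8 x
  obtain ⟨g, rfl⟩ := Submodule.Quotient.mk_surjective U8 y
  change ∑ i, f.1 (σ.symm i) * g.1 (σ.symm i) = ∑ i, f.1 i * g.1 i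
  exact Equiv.sum_comp σ.symm (fun i => f.1 i * g.1 i)

def permEquiv (σ : Equiv.Perm (Fin 8)) : E3 ≃ₗ[ZMod 2] E3 :=
  LinearEquiv.ofLinearMap (permE3 σ) (permE3 σ⁻¹)
    (LinearMap.ext fun x => by
      change permE3 σ (permE3 σ⁻¹ x) = x
      rw [← permE3_mul, mul_inv_cancel, permE3_one])
    (LinearMap.ext fun x => by
      change permE3 σ⁻¹ (permE3 σ x) = x
      rw [← permE3_mul, inv_mul_cancel, permE3_one])

def permHom : Equiv.Perm (Fin 8) →* Sp6 where
  toFun σ := ⟨permEquiv σ, fun x y => permE3_pairing σ x y⟩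
  map_one' := Subtype.ext (LinearEquiv.ext fun x => permE3_one x)
  map_mul' σ τ := Subtype.ext (LinearEquiv.ext fun x => permE3_mul σ τ x)

lemma permHom_toE3 (σ : Equiv.Perm (Fin 8)) (s : Finset (Fin 8)) (hs : Even s.card) :
    ((permHom σ : E3 ≃ₗ[ZMod 2] E3) : E3 → E3) (toE3 s hs) =
      toE3 (s.image σ) (by rwa [Finset.card_image_of_injective s σ.injective]) := by
  change Submodule.Quotient.mk (permV σ ⟨indV s, indV_mem s hs⟩) = Submodule.Quotient.mk _
  congr 1
  apply Subtype.ext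
  funext i
  change indV s (σ.symm i) = indV (s.image σ) i
  have : σ.symm i ∈ s ↔ i ∈ s.image σ := by
    rw [Finset.mem_image]
    constructor
    · intro h
      exact ⟨_, h, σ.apply_symm_apply i⟩
    · rintro ⟨a, ha, rfl⟩
      rwa [σ.symm_apply_apply]
  simp only [indV, this]

lemma permHom_inj : Function.Injective permHom := by
  rw [injective_iff_map_eq_one]
  intro σ hσ
  by_contra hne
  obtain ⟨i, hi⟩ : ∃ i, σ i ≠ i := by
    by_contra hcon
    push Not at hcon
    exact hne (Equiv.ext hcon)
  obtain ⟨k, hk⟩ : ∃ k, k ∉ ({i, σ i, σ.symm i} : Finset (Fin 8)) := by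
    by_contra hcon
    push Not at hcon
    have h1 := Finset.card_le_card (fun x _ => hcon x : (Finset.univ : Finset (Fin 8)) ⊆ _)
    have h2 := Finset.card_le_three (a := i) (b := σ i) (c := σ.symm i)
    rw [Finset.card_univ, Fintype.card_fin] at h1
    omega
  obtain ⟨m, hm⟩ : ∃ m, m ∉ ({i, k, σ i, σ k} : Finset (Fin 8)) := by
    by_contra hcon
    push Not at hcon
    have h1 := Finset.card_le_card (fun x _ => hcon x : (Finset.univ : Finset (Fin 8)) ⊆ _)
    have h2 := Finset.card_le_four (a := i) (b := k) (c := σ i) (d := σ k)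
    rw [Finset.card_univ, Fintype.card_fin] at h1
    omega
  simp only [Finset.mem_insert, Finset.mem_singleton, not_or] at hk hm
  obtain ⟨hk1, hk2, hk3⟩ := hk
  obtain ⟨hm1, hm2, hm3, hm4⟩ := hm
  have hki : i ≠ σ k := fun h => hk3 (by rw [h, σ.symm_apply_apply])
  have h := permHom_toE3 σ {i, k} (indV_pair i k (Ne.symm hk1))
  rw [hσ] at h
  change Submodule.Quotient.mk _ = Submodule.Quotient.mk _ at h
  rw [Submodule.Quotient.eq] at h
  obtain ⟨c, hc⟩ := Submodule.mem_span_singleton.mp h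
  have hci : c * 1 = indV {i, k} i - indV (({i, k} : Finset (Fin 8)).image σ) i :=
    congrFun (congrArg Subtype.val hc) i
  have hcm : c * 1 = indV {i, k} m - indV (({i, k} : Finset (Fin 8)).image σ) m :=
    congrFun (congrArg Subtype.val hc) m
  rw [Finset.image_insert, Finset.image_singleton] at hci hcm
  simp [indV, hm1, hm2, hm3, hm4] at hcm
  simp [indV, hki, Ne.symm hi, hcm] at hci

/-- The permutation action of `S₈` on the 8 labels induces `𝔽₂`-linear
automorphisms of `E₃` preserving the symplectic pairing; the resulting group homomorphism
`S₈ → Sp(6,2)` is injective and its image has index exactly 36 in `Sp(6,2)`. -/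
theorem s8_to_sp62_injective_index_36 :
    ∃ Φ : Equiv.Perm (Fin 8) →* Sp6,
      (∀ (σ : Equiv.Perm (Fin 8)) (s : Finset (Fin 8)) (hs : Even s.card),
        ((Φ σ : E3 ≃ₗ[ZMod 2] E3) : E3 → E3) (toE3 s hs) =
          toE3 (s.image σ)
            (by rwa [Finset.card_image_of_injective s σ.injective])) ∧
      Function.Injective Φ ∧
      (MonoidHom.range Φ).index = 36 := by
  refine ⟨permHom, permHom_toE3, permHom_inj, ?_⟩
  have h := Subgroup.card_mul_index (MonoidHom.range permHom)
  rw [card_Sp6, ← Nat.card_congr (MonoidHom.ofInjective permHom_inj).toEquiv,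
    Nat.card_eq_fintype_card, Fintype.card_perm, Fintype.card_fin] at h
  have h8 : Nat.factorial 8 = 40320 := by decide
  rw [h8] at h
  omega



end
end

section
/- Let L ⊆ ℤ^P be the set of integer vectors w satisfying w_{ABCD} + w_{ABEF} + w_{CEGH} + w_{DFGH} = w_{EFGH} + w_{CDGH} + w_{ABDF} + w_{ABCE} together with all the equations obtained from this one by permuting the eight labels (630 equations in total). Let L_pln ⊆ ℤ^P be the sublattice generated by the 35 vectors v_pln^Q + v_pln^{Λ∖Q}, where Q ranges over 4-element subsets of Λ, and let L_pt ⊆ ℤ^P be the sublattice generated by the 28 vectors v_pt^{{i,j}}, where {i,j} ranges over 2-element subsets of Λ. Then L is a lattice of rank 42, L_pln has rank 35, L_pt has rank 28, and L = L_pln + L_pt. -/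
open Finset

noncomputable section

/-- The index set of Plücker coordinates: the 4-element subsets of the 8 labels
`Λ = {A,…,H} = Fin 8`. -/
abbrev PIdx : Type := {Q : Finset (Fin 8) // Q.card = 4}

/-- The image of a 4-element subset of the labels under a permutation of the labels. -/
def permP (σ : Equiv.Perm (Fin 8)) (Q : PIdx) : PIdx :=
  ⟨Q.1.image σ, by rw [Finset.card_image_of_injective _ σ.injective]; exact Q.2⟩

/-- A 4-element subset of the labels given by four distinct labels. -/
def q4 (a b c d : Fin 8) (h : ({a, b, c, d} : Finset (Fin 8)).card = 4) : PIdx := ⟨_, h⟩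

/-- The left-hand side of the Cayley relation permuted by `σ`, in additive (valuation)
form: `w_{σ(ABCD)} + w_{σ(ABEF)} + w_{σ(CEGH)} + w_{σ(DFGH)}`. -/
def lhsRel (σ : Equiv.Perm (Fin 8)) (w : PIdx → ℤ) : ℤ :=
  w (permP σ (q4 0 1 2 3 (by decide))) + w (permP σ (q4 0 1 4 5 (by decide))) +
    w (permP σ (q4 2 4 6 7 (by decide))) + w (permP σ (q4 3 5 6 7 (by decide)))

/-- The right-hand side of the Cayley relation permuted by `σ`, in additive (valuation)
form: `w_{σ(EFGH)} + w_{σ(CDGH)} + w_{σ(ABDF)} + w_{σ(ABCE)}`. -/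
def rhsRel (σ : Equiv.Perm (Fin 8)) (w : PIdx → ℤ) : ℤ :=
  w (permP σ (q4 4 5 6 7 (by decide))) + w (permP σ (q4 2 3 6 7 (by decide))) +
    w (permP σ (q4 0 1 3 5 (by decide))) + w (permP σ (q4 0 1 2 4 (by decide)))

/-- The lattice `L ⊆ ℤ^P` of integer vectors satisfying the 630 additive Cayley relations
(obtained from `w_{ABCD} + w_{ABEF} + w_{CEGH} + w_{DFGH} = w_{EFGH} + w_{CDGH} + w_{ABDF} +
w_{ABCE}` by permuting the eight labels). -/
def Lcayley : Submodule ℤ (PIdx → ℤ) where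
  carrier := {w | ∀ σ : Equiv.Perm (Fin 8), lhsRel σ w = rhsRel σ w}
  add_mem' := by
    intro a b ha hb σ
    have h1 := ha σ
    have h2 := hb σ
    simp only [lhsRel, rhsRel, Pi.add_apply] at *
    omega
  zero_mem' := by
    intro σ
    simp [lhsRel, rhsRel]
  smul_mem' := by
    intro c w hw σ
    have h := hw σ
    simp only [lhsRel, rhsRel, Pi.smul_apply, smul_eq_mul] at *
    linear_combination c * h

/-- `v_pt^T`, with `v_pt^T(Q) = max (0, |Q ∩ T| - 1)`. -/
def vptZ (T : Finset (Fin 8)) : PIdx → ℤ := fun Q => max (((Q.1 ∩ T).card : ℤ) - 1) 0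

/-- `v_pln^T`, with `v_pln^T(Q) = max (0, |Q ∩ T| - 3)`. -/
def vplnZ (T : Finset (Fin 8)) : PIdx → ℤ := fun Q => max (((Q.1 ∩ T).card : ℤ) - 3) 0

/-- The sublattice generated by the 35 vectors `v_pln^Q + v_pln^{Λ∖Q}`, for `Q` a 4-element
subset of the labels. -/
def Lpln : Submodule ℤ (PIdx → ℤ) :=
  Submodule.span ℤ {w | ∃ Q : PIdx, w = vplnZ Q.1 + vplnZ Q.1ᶜ}

/-- The sublattice generated by the 28 vectors `v_pt^{{i,j}}`, for `{i,j}` a 2-element subset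
of the labels. -/
def Lpt : Submodule ℤ (PIdx → ℤ) :=
  Submodule.span ℤ {w | ∃ i j : Fin 8, i ≠ j ∧ w = vptZ {i, j}}

/-- complement on `PIdx` -/
def cP (Q : PIdx) : PIdx := ⟨Q.1ᶜ, by rw [Finset.card_compl, Q.2]; rfl⟩

lemma cP_cP (Q : PIdx) : cP (cP Q) = Q := by
  apply Subtype.ext; simp [cP]

lemma permP_cP (σ : Equiv.Perm (Fin 8)) (Q : PIdx) : permP σ (cP Q) = cP (permP σ Q) := by
  apply Subtype.ext
  simp only [permP, cP]
  ext t
  obtain ⟨u, rfl⟩ := σ.surjective t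
  simp

/-- the antisymmetrisation functional, extended by zero to all finsets -/
def dL (S : Finset (Fin 8)) : (PIdx → ℤ) →ₗ[ℤ] ℤ :=
  if h : S.card = 4 then
    (LinearMap.proj (R := ℤ) (φ := fun _ : PIdx => ℤ) (⟨S, h⟩ : PIdx)) -
      LinearMap.proj (R := ℤ) (φ := fun _ : PIdx => ℤ) (cP ⟨S, h⟩) else 0

lemma dL_apply (Q : PIdx) (w : PIdx → ℤ) : dL Q.1 w = w Q - w (cP Q) := by
  simp [dL, Q.2]

lemma dL_compl (Q : PIdx) (w : PIdx → ℤ) : dL (Q.1)ᶜ w = - dL Q.1 w := by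
  have := dL_apply (cP Q) w
  rw [cP_cP] at this
  rw [dL_apply]
  change dL (cP Q).1 w = _
  rw [this]; ring

lemma mem_L_iff (w : PIdx → ℤ) : w ∈ Lcayley ↔ ∀ σ : Equiv.Perm (Fin 8),
    dL (permP σ (q4 0 1 2 3 (by decide))).1 w + dL (permP σ (q4 0 1 4 5 (by decide))).1 w =
    dL (permP σ (q4 0 1 3 5 (by decide))).1 w + dL (permP σ (q4 0 1 2 4 (by decide))).1 w := by
  have e1 : cP (q4 0 1 2 3 (by decide)) = q4 4 5 6 7 (by decide) := Subtype.ext (by decide)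
  have e2 : cP (q4 0 1 4 5 (by decide)) = q4 2 3 6 7 (by decide) := Subtype.ext (by decide)
  have e3 : cP (q4 0 1 3 5 (by decide)) = q4 2 4 6 7 (by decide) := Subtype.ext (by decide)
  have e4 : cP (q4 0 1 2 4 (by decide)) = q4 3 5 6 7 (by decide) := Subtype.ext (by decide)
  change (∀ σ, lhsRel σ w = rhsRel σ w) ↔ _
  refine forall_congr' fun σ => ?_
  simp only [dL_apply, ← permP_cP, e1, e2, e3, e4, lhsRel, rhsRel]
  constructor <;> intro h <;> linarith

lemma sym_mem_L {w : PIdx → ℤ} (h : ∀ Q, w (cP Q) = w Q) : w ∈ Lcayley := by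
  rw [mem_L_iff]; intro σ; simp [dL_apply, h]

/-- indicator of `i ∈ Q` -/
def ind (i : Fin 8) (Q : PIdx) : ℤ := if i ∈ Q.1 then 1 else 0

lemma ind_cP (i : Fin 8) (Q : PIdx) : ind i (cP Q) = 1 - ind i Q := by
  by_cases h : i ∈ Q.1 <;> simp [ind, cP, h]

lemma vptZ_eq {i j : Fin 8} (h : i ≠ j) (Q : PIdx) : vptZ {i, j} Q = ind i Q * ind j Q := by
  by_cases hi : i ∈ Q.1 <;> by_cases hj : j ∈ Q.1 <;>
    simp [vptZ, ind, hi, hj, Finset.inter_insert_of_mem, Finset.inter_insert_of_notMem,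
      Finset.inter_singleton_of_mem, Finset.inter_singleton_of_notMem, h]

lemma dL_vptZ {i j : Fin 8} (h : i ≠ j) (Q : PIdx) :
    dL Q.1 (vptZ {i, j}) = ind i Q + ind j Q - 1 := by
  rw [dL_apply, vptZ_eq h, vptZ_eq h, ind_cP, ind_cP]; ring

lemma ind_permP (i : Fin 8) (σ : Equiv.Perm (Fin 8)) (Q : PIdx) :
    ind (σ i) (permP σ Q) = ind i Q := by
  simp [ind, permP]

lemma ind_rel (i : Fin 8) (σ : Equiv.Perm (Fin 8)) :
    ind i (permP σ (q4 0 1 2 3 (by decide))) + ind i (permP σ (q4 0 1 4 5 (by decide))) =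
    ind i (permP σ (q4 0 1 3 5 (by decide))) + ind i (permP σ (q4 0 1 2 4 (by decide))) := by
  obtain ⟨i, rfl⟩ := σ.surjective i
  simp only [ind_permP]
  fin_cases i <;> simp [ind, q4]

lemma vptZ_mem {i j : Fin 8} (h : i ≠ j) : vptZ {i, j} ∈ Lcayley := by
  rw [mem_L_iff]; intro σ
  simp only [dL_vptZ h]
  linarith [ind_rel i σ, ind_rel j σ]

lemma ind_mem (i : Fin 8) : ind i ∈ Lcayley := by
  rw [mem_L_iff]; intro σ
  simp only [dL_apply, ind_cP]
  linarith [ind_rel i σ]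

lemma card_inter_compl (Q R : PIdx) : (R.1 ∩ Q.1).card + (R.1 ∩ Q.1ᶜ).card = 4 := by
  have := Finset.card_inter_add_card_sdiff R.1 Q.1
  rw [Finset.sdiff_eq_inter_compl] at this
  rw [this, R.2]

lemma vpln_eq (Q R : PIdx) : (vplnZ Q.1 + vplnZ Q.1ᶜ) R = if R = Q ∨ R = cP Q then 1 else 0 := by
  have h1 := card_inter_compl Q R
  have key : ∀ A B : PIdx, (A.1 ∩ B.1).card = 4 ↔ A = B := by
    intro A B
    constructor
    · intro h
      apply Subtype.ext
      have a := Finset.eq_of_subset_of_card_le (Finset.inter_subset_left (s₁ := A.1) (s₂ := B.1))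
        (by rw [h, A.2])
      have b := Finset.eq_of_subset_of_card_le (Finset.inter_subset_right (s₁ := A.1) (s₂ := B.1))
        (by rw [h, B.2])
      rw [← a, b]
    · rintro rfl; simp [A.2]
  have h2 := key R Q
  have h3 : (R.1 ∩ Q.1ᶜ).card = 4 ↔ R = cP Q := key R (cP Q)
  simp only [← h2, ← h3]
  simp only [vplnZ, Pi.add_apply]
  split_ifs with h <;> omega

lemma vpln_sym (Q R : PIdx) :
    (vplnZ Q.1 + vplnZ Q.1ᶜ) (cP R) = (vplnZ Q.1 + vplnZ Q.1ᶜ) R := by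
  rw [vpln_eq, vpln_eq]
  have e1 : cP R = Q ↔ R = cP Q := ⟨fun h => by rw [← h, cP_cP], fun h => by rw [h, cP_cP]⟩
  have e2 : cP R = cP Q ↔ R = Q := ⟨fun h => by rw [← cP_cP R, h, cP_cP], fun h => by rw [h]⟩
  simp only [e1, e2, or_comm]

/-- representatives of complementary pairs -/
abbrev Half : Type := {Q : PIdx // (0 : Fin 8) ∈ Q.1}

lemma card_Half : Fintype.card Half = 35 := by
  have e : Half ≃ {T // T ∈ (Finset.powersetCard 4 (Finset.univ : Finset (Fin 8))).filter
      (fun T => 0 ∈ T)} :=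
    { toFun := fun Q => ⟨Q.1.1, by simp [Q.2, Q.1.2]⟩
      invFun := fun T => ⟨⟨T.1, (Finset.mem_powersetCard.1 (Finset.mem_filter.1 T.2).1).2⟩,
        (Finset.mem_filter.1 T.2).2⟩
      left_inv := fun _ => rfl
      right_inv := fun _ => rfl }
  rw [Fintype.card_congr e, Fintype.card_coe]
  decide +kernel

/-- symmetric extension -/
def symExt : (Half → ℤ) →ₗ[ℤ] (PIdx → ℤ) where
  toFun f Q := if h : (0 : Fin 8) ∈ Q.1 then f ⟨Q, h⟩ else
    f ⟨cP Q, by simpa [cP] using h⟩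
  map_add' f g := by ext Q; by_cases h : (0 : Fin 8) ∈ Q.1 <;> simp [h]
  map_smul' c f := by ext Q; by_cases h : (0 : Fin 8) ∈ Q.1 <;> simp [h]

lemma symExt_half (f : Half → ℤ) (Q : Half) : symExt f Q.1 = f Q := by
  simp [symExt, Q.2]

lemma symExt_sym (f : Half → ℤ) (Q : PIdx) : symExt f (cP Q) = symExt f Q := by
  by_cases h : (0 : Fin 8) ∈ Q.1
  · have h' : ¬ (0 : Fin 8) ∈ (cP Q).1 := by simpa [cP] using h
    simp [symExt, h, h', cP_cP]
  · have h' : (0 : Fin 8) ∈ (cP Q).1 := by simpa [cP] using h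
    simp [symExt, h, h']

lemma symExt_inj : Function.Injective symExt := by
  intro f g h; ext Q; rw [← symExt_half f, h, symExt_half]

lemma symExt_of_sym {w : PIdx → ℤ} (h : ∀ Q, w (cP Q) = w Q) :
    symExt (fun Q => w Q.1) = w := by
  ext Q
  by_cases h0 : (0 : Fin 8) ∈ Q.1 <;> simp [symExt, h0, h]

lemma Lpln_eq_range : Lpln = LinearMap.range symExt := by
  apply le_antisymm
  · apply Submodule.span_le.2
    rintro w ⟨Q, rfl⟩
    exact ⟨_, symExt_of_sym (vpln_sym Q)⟩
  · rintro _ ⟨f, rfl⟩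
    have : symExt f = ∑ Q : Half, f Q • (vplnZ Q.1.1 + vplnZ Q.1.1ᶜ) := by
      rw [← symExt_of_sym (w := ∑ Q : Half, f Q • (vplnZ Q.1.1 + vplnZ Q.1.1ᶜ))]
      · congr 1
        ext R
        rw [Finset.sum_apply, Finset.sum_eq_single R]
        · rw [Pi.smul_apply, vpln_eq]; simp
        · intro Q _ hQ
          rw [Pi.smul_apply, vpln_eq, if_neg]
          · simp
          · rintro (h | h)
            · exact hQ (Subtype.ext h.symm)
            · have := R.2
              rw [h] at this
              simp [cP, Q.2] at this
        · simp
      · intro R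
        simp only [Finset.sum_apply, Pi.smul_apply, vpln_sym]
    rw [this]
    exact Submodule.sum_mem _ fun Q _ => Submodule.smul_mem _ _ (Submodule.subset_span ⟨Q.1, rfl⟩)

lemma sym_mem_Lpln {w : PIdx → ℤ} (h : ∀ Q, w (cP Q) = w Q) : w ∈ Lpln := by
  rw [Lpln_eq_range]; exact ⟨_, symExt_of_sym h⟩

lemma finrank_Lpln : Module.finrank ℤ Lpln = 35 := by
  rw [Lpln_eq_range, LinearMap.finrank_range_of_inj symExt_inj, Module.finrank_fintype_fun_eq_card,
    card_Half]

/-! The exchange argument -/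

/-- exchange difference -/
def exch (i j : Fin 8) (S : Finset (Fin 8)) : (PIdx → ℤ) →ₗ[ℤ] ℤ := dL (insert i S) - dL (insert j S)

lemma set_perm1 (i x a b : Fin 8) : ({i, x, a, b} : Finset (Fin 8)) = {a, b, x, i} := by
  ext t; simp only [Finset.mem_insert, Finset.mem_singleton]; tauto
lemma set_perm2 (i x a b : Fin 8) : ({i, x, a, b} : Finset (Fin 8)) = {a, b, i, x} := by
  ext t; simp only [Finset.mem_insert, Finset.mem_singleton]; tauto
lemma set_perm3 (i x a b : Fin 8) : ({i, x, a, b} : Finset (Fin 8)) = {x, a, b, i} := by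
  ext t; simp only [Finset.mem_insert, Finset.mem_singleton]; tauto

lemma exch_swap {w : PIdx → ℤ} (hw : w ∈ Lcayley) {i j x y : Fin 8} {R : Finset (Fin 8)}
    (hR : R.card = 2) (hij : i ≠ j) (hxy : x ≠ y) (hi : i ∉ insert x (insert y R))
    (hj : j ∉ insert x (insert y R)) (hx : x ∉ R) (hy : y ∉ R) :
    exch i j (insert x R) w = exch i j (insert y R) w := by
  obtain ⟨a, b, hab, rfl⟩ := Finset.card_eq_two.1 hR
  simp only [Finset.mem_insert, Finset.mem_singleton, not_or] at hi hj hx hy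
  obtain ⟨hi1, hi2, hi3, hi4⟩ := hi
  obtain ⟨hj1, hj2, hj3, hj4⟩ := hj
  obtain ⟨hx1, hx2⟩ := hx
  obtain ⟨hy1, hy2⟩ := hy
  have hc : (({a, b, x, i, j, y} : Finset (Fin 8))ᶜ).card = 2 := by
    rw [Finset.card_compl]
    have : ({a, b, x, i, j, y} : Finset (Fin 8)).card = 6 := by
      rw [Finset.card_insert_of_notMem, Finset.card_insert_of_notMem, Finset.card_insert_of_notMem,
        Finset.card_insert_of_notMem, Finset.card_insert_of_notMem, Finset.card_singleton] <;>
      simp only [Finset.mem_insert, Finset.mem_singleton, not_or] <;> simp [*, Ne.symm, eq_comm]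
    rw [this]; rfl
  obtain ⟨g, h, hgh, hE⟩ := Finset.card_eq_two.1 hc
  have hg : g ∉ ({a, b, x, i, j, y} : Finset (Fin 8)) := by
    rw [← Finset.mem_compl, hE]; simp
  have hh : h ∉ ({a, b, x, i, j, y} : Finset (Fin 8)) := by
    rw [← Finset.mem_compl, hE]; simp
  simp only [Finset.mem_insert, Finset.mem_singleton, not_or] at hg hh
  have hinj : Function.Injective ![a, b, x, i, j, y, g, h] := by
    rw [← List.nodup_ofFn]
    simp
    grind
  let σ : Equiv.Perm (Fin 8) := Equiv.ofBijective _ (Finite.injective_iff_bijective.1 hinj)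
  have h1 := (mem_L_iff w).1 hw σ
  have e0 : σ 0 = a := rfl
  have e1 : σ 1 = b := rfl
  have e2 : σ 2 = x := rfl
  have e3 : σ 3 = i := rfl
  have e4 : σ 4 = j := rfl
  have e5 : σ 5 = y := rfl
  simp only [permP, q4, Finset.image_insert, Finset.image_singleton, e0, e1, e2, e3, e4, e5] at h1
  have s1 : ({i, x, a, b} : Finset (Fin 8)) = {a, b, x, i} := set_perm1 _ _ _ _
  have s2 : ({j, x, a, b} : Finset (Fin 8)) = {a, b, x, j} := set_perm1 _ _ _ _
  have s3 : ({i, y, a, b} : Finset (Fin 8)) = {a, b, i, y} := set_perm2 _ _ _ _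
  have s4 : ({j, y, a, b} : Finset (Fin 8)) = {a, b, j, y} := set_perm2 _ _ _ _
  simp only [exch, LinearMap.sub_apply, s1, s2, s3, s4]
  linarith

lemma exch_indep {w : PIdx → ℤ} (hw : w ∈ Lcayley) {i j : Fin 8} (hij : i ≠ j)
    {S' : Finset (Fin 8)} (hS' : S'.card = 3) (hi' : i ∉ S') (hj' : j ∉ S') :
    ∀ (n : ℕ) (S : Finset (Fin 8)), (S \ S').card = n → S.card = 3 → i ∉ S → j ∉ S →
      exch i j S w = exch i j S' w := by
  intro n
  induction n with
  | zero =>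
    intro S h0 h3 _ _
    have : S ⊆ S' := by simpa [Finset.sdiff_eq_empty_iff_subset] using h0
    rw [Finset.eq_of_subset_of_card_le this (by omega)]
  | succ n ih =>
    intro S hn h3 hi hj
    obtain ⟨x, hx⟩ : (S \ S').Nonempty := Finset.card_pos.1 (by omega)
    have hc : (S' \ S).card = (S \ S').card := Finset.card_sdiff_comm (by omega)
    obtain ⟨y, hy⟩ : (S' \ S).Nonempty := Finset.card_pos.1 (by omega)
    rw [Finset.mem_sdiff] at hx hy
    have hR : (S.erase x).card = 2 := by rw [Finset.card_erase_of_mem hx.1, h3]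
    have hyR : y ∉ S.erase x := fun h => hy.2 (Finset.mem_of_mem_erase h)
    have hiy : i ≠ y := by rintro rfl; exact hi' hy.1
    have hjy : j ≠ y := by rintro rfl; exact hj' hy.1
    have hix : i ≠ x := by rintro rfl; exact hi hx.1
    have hjx : j ≠ x := by rintro rfl; exact hj hx.1
    have hxy : x ≠ y := by rintro rfl; exact hx.2 hy.1
    have := exch_swap hw (i := i) (j := j) (x := x) (y := y) (R := S.erase x) hR hij hxy
      (by simp [*]) (by simp [*]) (by simp) hyR
    rw [Finset.insert_erase hx.1] at this
    rw [this]
    apply ih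
    · have : insert y (S.erase x) \ S' = (S \ S').erase x := by
        ext t; simp only [Finset.mem_sdiff, Finset.mem_insert, Finset.mem_erase]
        constructor
        · rintro ⟨rfl | h, h'⟩
          · exact absurd hy.1 h'
          · exact ⟨h.1, h.2, h'⟩
        · rintro ⟨h, h', h''⟩
          exact ⟨Or.inr ⟨h, h'⟩, h''⟩
      rw [this, Finset.card_erase_of_mem (by simp [hx]), hn]; rfl
    · rw [Finset.card_insert_of_notMem hyR, hR]
    · simp [*]
    · simp [*]

/-- a chosen triple avoiding `0` and `i` -/
def sel (i : Fin 8) : Finset (Fin 8) := if i = 1 ∨ i = 2 ∨ i = 3 then {4, 5, 6} else {1, 2, 3}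

lemma sel_card (i : Fin 8) : (sel i).card = 3 := by
  unfold sel; split_ifs <;> rfl
lemma sel_zero (i : Fin 8) : 0 ∉ sel i := by
  unfold sel; split_ifs <;> decide
lemma sel_self (i : Fin 8) : i ∉ sel i := by revert i; unfold sel; decide

/-- the weights -/
def bet (i : Fin 8) : (PIdx → ℤ) →ₗ[ℤ] ℤ := exch i 0 (sel i)

lemma bet_zero (w) : bet 0 w = 0 := by simp [bet, exch]

lemma exch_zero {w : PIdx → ℤ} (hw : w ∈ Lcayley) (i : Fin 8) {S : Finset (Fin 8)}
    (h3 : S.card = 3) (hi : i ∉ S) (h0 : 0 ∉ S) : exch i 0 S w = bet i w := by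
  by_cases h : i = 0
  · subst h; simp [bet, exch]
  · exact exch_indep hw h (sel_card i) (sel_self i) (sel_zero i) _ S rfl h3 hi h0

lemma exch_bet {w : PIdx → ℤ} (hw : w ∈ Lcayley) {i j : Fin 8} {S : Finset (Fin 8)}
    (h3 : S.card = 3) (hi : i ∉ S) (hj : j ∉ S) : exch i j S w = bet i w - bet j w := by
  by_cases h : i = j
  · subst h; simp [exch]
  have : 3 ≤ (({i, j, 0} : Finset (Fin 8))ᶜ).card := by
    rw [Finset.card_compl]
    have := Finset.card_le_three (a := i) (b := j) (c := 0)
    simp only [Fintype.card_fin]; omega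
  obtain ⟨T, hT, hT3⟩ := Finset.exists_subset_card_eq this
  have nm : ∀ t ∈ ({i, j, 0} : Finset (Fin 8)), t ∉ T := fun t ht h' =>
    (Finset.mem_compl.1 (hT h')) ht
  have a := nm i (by simp)
  have b := nm j (by simp)
  have c := nm 0 (by simp)
  rw [exch_indep hw h hT3 a b _ S rfl h3 hi hj, ← exch_zero hw i hT3 a c, ← exch_zero hw j hT3 b c]
  simp [exch]

lemma exists_four (S : Finset (Fin 8)) (h : S.card = 4) : ∃ a b c d : Fin 8,
    a ≠ b ∧ a ≠ c ∧ a ≠ d ∧ b ≠ c ∧ b ≠ d ∧ c ≠ d ∧ S = {a, b, c, d} := by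
  obtain ⟨a, t, hat, rfl, ht⟩ := Finset.card_eq_succ.1 h
  obtain ⟨b, c, d, hbc, hbd, hcd, rfl⟩ := Finset.card_eq_three.1 ht
  simp at hat
  exact ⟨a, b, c, d, hat.1, hat.2.1, hat.2.2, hbc, hbd, hcd, rfl⟩

set_option maxHeartbeats 2000000 in
lemma two_dL {w : PIdx → ℤ} (hw : w ∈ Lcayley) (Q : PIdx) :
    2 * dL Q.1 w = ∑ i ∈ Q.1, bet i w - ∑ i ∈ Q.1ᶜ, bet i w := by
  obtain ⟨a, b, c, d, h1, h2, h3, h4, h5, h6, hQ⟩ := exists_four Q.1 Q.2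
  obtain ⟨e, f, g, h, k1, k2, k3, k4, k5, k6, hQc⟩ := exists_four (Q.1)ᶜ (cP Q).2
  have hcm := dL_compl Q w
  have cross : ∀ t ∈ ({e, f, g, h} : Finset (Fin 8)), t ≠ a ∧ t ≠ b ∧ t ≠ c ∧ t ≠ d := by
    intro t ht
    rw [← hQc, Finset.mem_compl, hQ] at ht
    simpa using ht
  have ce := cross e (by simp)
  have cf := cross f (by simp)
  have cg := cross g (by simp)
  have ch := cross h (by simp)
  rw [hQc, hQ] at hcm
  rw [hQc, hQ]
  clear hQ hQc cross
  have x1 := exch_bet hw (i := a) (j := e) (S := {b, c, d})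
    (Finset.card_eq_three.2 ⟨_, _, _, h4, h5, h6, rfl⟩) (by simp; tauto) (by simp; tauto)
  have x2 := exch_bet hw (i := b) (j := f) (S := {c, d, e})
    (Finset.card_eq_three.2 ⟨_, _, _, by tauto, by tauto, by tauto, rfl⟩)
    (by simp; grind) (by simp; grind)
  have x3 := exch_bet hw (i := c) (j := g) (S := {d, e, f})
    (Finset.card_eq_three.2 ⟨_, _, _, by tauto, by tauto, by tauto, rfl⟩)
    (by simp; grind) (by simp; grind)
  have x4 := exch_bet hw (i := d) (j := h) (S := {e, f, g})
    (Finset.card_eq_three.2 ⟨_, _, _, by tauto, by tauto, by tauto, rfl⟩)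
    (by simp; grind) (by simp; grind)
  have s1 : ({e, b, c, d} : Finset (Fin 8)) = {b, c, d, e} := set_perm3 _ _ _ _
  have s2 : ({f, c, d, e} : Finset (Fin 8)) = {c, d, e, f} := set_perm3 _ _ _ _
  have s3 : ({g, d, e, f} : Finset (Fin 8)) = {d, e, f, g} := set_perm3 _ _ _ _
  have s4 : ({h, e, f, g} : Finset (Fin 8)) = {e, f, g, h} := set_perm3 _ _ _ _
  simp only [exch, LinearMap.sub_apply, s1, s2, s3, s4] at x1 x2 x3 x4
  rw [Finset.sum_insert (by simp; tauto), Finset.sum_insert (by simp; tauto),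
    Finset.sum_insert (by simp; tauto), Finset.sum_singleton,
    Finset.sum_insert (by simp; tauto), Finset.sum_insert (by simp; tauto),
    Finset.sum_insert (by simp; tauto), Finset.sum_singleton]
  linarith

lemma sum_ind (b : Fin 8 → ℤ) (Q : PIdx) : ∑ i ∈ Q.1, b i = ∑ i, b i * ind i Q := by
  simp [ind, Finset.sum_ite_mem]

lemma L_eq : Lcayley = Lpln ⊔ Lpt := by
  apply le_antisymm
  · intro w hw
    have hall : ∀ Q : PIdx, dL Q.1 w = ∑ i, bet i w * ind i Q -
        (∑ i ∈ (q4 0 1 2 3 (by decide)).1, bet i w - dL (q4 0 1 2 3 (by decide)).1 w) := by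
      intro Q
      have t1 := two_dL hw Q
      have t2 := two_dL hw (q4 0 1 2 3 (by decide))
      have t3 := Finset.sum_add_sum_compl Q.1 (fun i => bet i w)
      have t4 := Finset.sum_add_sum_compl (q4 0 1 2 3 (by decide)).1 (fun i => bet i w)
      rw [← sum_ind (fun i => bet i w)]
      linarith
    have htot : ∑ i, bet i w = 2 * (∑ i ∈ (q4 0 1 2 3 (by decide)).1, bet i w -
        dL (q4 0 1 2 3 (by decide)).1 w) := by
      have t2 := two_dL hw (q4 0 1 2 3 (by decide))
      have t4 := Finset.sum_add_sum_compl (q4 0 1 2 3 (by decide)).1 (fun i => bet i w)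
      linarith
    generalize (∑ i ∈ (q4 0 1 2 3 (by decide)).1, bet i w -
        dL (q4 0 1 2 3 (by decide)).1 w) = m at hall htot
    have n01 : (0 : Fin 8) ≠ 1 := by decide
    have n02 : (0 : Fin 8) ≠ 2 := by decide
    have n12 : (1 : Fin 8) ≠ 2 := by decide
    let u : PIdx → ℤ := ∑ i : Fin 7, bet i.succ w • vptZ {0, i.succ} -
      m • (vptZ {0, 1} + vptZ {0, 2} - vptZ {1, 2})
    have gen : ∀ i j : Fin 8, i ≠ j → vptZ {i, j} ∈ Lpt := fun i j h =>
      Submodule.subset_span ⟨i, j, h, rfl⟩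
    have hu : u ∈ Lpt := by
      refine Submodule.sub_mem _ (Submodule.sum_mem _ fun i _ => Submodule.smul_mem _ _ (gen _ _ ?_))
        (Submodule.smul_mem _ _ (Submodule.sub_mem _ (Submodule.add_mem _ (gen _ _ n01)
          (gen _ _ n02)) (gen _ _ n12)))
      exact (Fin.succ_ne_zero i).symm
    have hd : ∀ Q : PIdx, dL Q.1 u = dL Q.1 w := by
      intro Q
      rw [hall Q]
      simp only [u, map_sub, map_sum, map_add, map_smul, dL_vptZ n01, dL_vptZ n02, dL_vptZ n12,
        dL_vptZ (Fin.succ_ne_zero _).symm, smul_eq_mul]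
      rw [Fin.sum_univ_succ, bet_zero] at htot
      rw [Fin.sum_univ_succ (fun i => bet i w * ind i Q), bet_zero]
      have : ∑ i : Fin 7, bet i.succ w * (ind 0 Q + ind i.succ Q - 1) =
          (∑ i : Fin 7, bet i.succ w * ind i.succ Q) + (∑ i : Fin 7, bet i.succ w) * (ind 0 Q - 1) := by
        rw [Finset.sum_mul, ← Finset.sum_add_distrib]
        exact Finset.sum_congr rfl fun i _ => by ring
      rw [this]
      linear_combination (ind 0 Q - 1) * htot
    have : w = (w - u) + u := by abel
    rw [this]
    refine Submodule.add_mem_sup (sym_mem_Lpln fun Q => ?_) hu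
    have := hd Q
    rw [dL_apply, dL_apply] at this
    simp only [Pi.sub_apply]; linarith
  · apply sup_le
    · rw [Lpln_eq_range]
      rintro _ ⟨f, rfl⟩
      exact sym_mem_L (symExt_sym f)
    · apply Submodule.span_le.2
      rintro w ⟨i, j, h, rfl⟩
      exact vptZ_mem h

/-- upper bound map -/
def upMap : Lcayley →ₗ[ℤ] (Half → ℤ) × (Fin 7 → ℤ) :=
  (LinearMap.prod (LinearMap.pi fun Q : Half => LinearMap.proj Q.1)
    (LinearMap.pi fun i : Fin 7 => bet i.succ)) ∘ₗ Lcayley.subtype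

lemma upMap_inj : Function.Injective upMap := by
  rw [injective_iff_map_eq_zero]
  rintro ⟨w, hw⟩ h
  have h1 : ∀ Q : Half, w Q.1 = 0 := fun Q => congrFun (congrArg Prod.fst h) Q
  have h2 : ∀ i : Fin 7, bet i.succ w = 0 := fun i => congrFun (congrArg Prod.snd h) i
  have h3 : ∀ i, bet i w = 0 := by
    intro i
    induction i using Fin.cases with
    | zero => exact bet_zero w
    | succ i => exact h2 i
  apply Subtype.ext
  funext Q
  change w Q = 0
  have h4 := two_dL hw Q
  simp only [h3, Finset.sum_const_zero, dL_apply] at h4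
  by_cases h0 : (0 : Fin 8) ∈ Q.1
  · exact h1 ⟨Q, h0⟩
  · have : w (cP Q) = 0 := h1 ⟨cP Q, by simpa [cP] using h0⟩
    omega

/-- lower bound map -/
def lowMap : (Half → ℤ) × (Fin 7 → ℤ) →ₗ[ℤ] Lcayley :=
  LinearMap.codRestrict Lcayley
    (symExt.coprod (Fintype.linearCombination ℤ fun i : Fin 7 => ind i.succ))
    (by
      rintro ⟨f, c⟩
      rw [LinearMap.coprod_apply]
      refine Submodule.add_mem _ (sym_mem_L (symExt_sym f)) ?_
      rw [Fintype.linearCombination_apply]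
      exact Submodule.sum_mem _ fun i _ => Submodule.smul_mem _ _ (ind_mem _))

lemma lowMap_inj : Function.Injective lowMap := by
  rw [injective_iff_map_eq_zero]
  rintro ⟨f, c⟩ h
  have h1 : symExt f + ∑ i : Fin 7, c i • ind i.succ = 0 := by
    have := congrArg Subtype.val h
    simpa [lowMap, Fintype.linearCombination_apply] using this
  have h2 : ∀ Q : PIdx, ∑ i : Fin 7, c i * (2 * ind i.succ Q - 1) = 0 := by
    intro Q
    have a := congrFun h1 Q
    have b := congrFun h1 (cP Q)
    simp only [Pi.add_apply, Finset.sum_apply, Pi.smul_apply, smul_eq_mul, symExt_sym, ind_cP,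
      Pi.zero_apply] at a b
    have : ∑ i : Fin 7, c i * (2 * ind i.succ Q - 1) =
      ∑ i : Fin 7, c i * ind i.succ Q - ∑ i : Fin 7, c i * (1 - ind i.succ Q) := by
      rw [← Finset.sum_sub_distrib]
      exact Finset.sum_congr rfl fun i _ => by ring
    rw [this]; linarith
  have h3 : ∀ i, c i = 0 := by
    intro i
    have hs0 := sel_zero i.succ
    have hss := sel_self i.succ
    have a := h2 ⟨insert i.succ (sel i.succ), by
      rw [Finset.card_insert_of_notMem hss, sel_card]⟩
    have b := h2 ⟨insert 0 (sel i.succ), by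
      rw [Finset.card_insert_of_notMem hs0, sel_card]⟩
    have e : ∑ k : Fin 7, c k * (if k = i then 2 else 0) = 0 := by
      have ab := congrArg₂ (fun s t : ℤ => s - t) a b
      simp only [← Finset.sum_sub_distrib, sub_self] at ab
      refine Eq.trans ?_ ab
      refine Finset.sum_congr rfl fun k _ => ?_
      by_cases hk : k = i
      · subst hk; simp [ind, hss]; ring
      · simp [ind, hk]
    simpa using e
  have hc : c = 0 := funext h3
  subst hc
  have : f = 0 := symExt_inj (by rw [map_zero]; simpa using h1)
  subst this; rfl

lemma finrank_L : Module.finrank ℤ Lcayley = 42 := by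
  have hr : Module.finrank ℤ ((Half → ℤ) × (Fin 7 → ℤ)) = 42 := by
    rw [Module.finrank_prod, Module.finrank_fintype_fun_eq_card, Module.finrank_fintype_fun_eq_card,
      card_Half, Fintype.card_fin]
  apply le_antisymm
  · rw [← hr]; exact LinearMap.finrank_le_finrank_of_injective upMap_inj
  · rw [← hr]; exact LinearMap.finrank_le_finrank_of_injective lowMap_inj

/-! Rank of `Lpt` -/

/-- index type of pairs -/
abbrev Pr : Type := {p : Fin 8 × Fin 8 // p.1 < p.2}

lemma pair_lin (C : Fin 8 → Fin 8 → ℤ) (hs : ∀ i j, C i j = C j i)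
    (hQ : ∀ a b c d : Fin 8, a ≠ b → a ≠ c → a ≠ d → b ≠ c → b ≠ d → c ≠ d →
      C a b + C a c + C a d + C b c + C b d + C c d = 0) (x y : Fin 8) (hxy : x ≠ y) :
    C x y = 0 := by
  have hc : 4 ≤ (({x, y} : Finset (Fin 8))ᶜ).card := by
    rw [Finset.card_compl, Finset.card_pair hxy]; decide
  obtain ⟨T, hT, hT4⟩ := Finset.exists_subset_card_eq hc
  obtain ⟨a, b, c, d, h1, h2, h3, h4, h5, h6, rfl⟩ := exists_four T hT4
  have nm : ∀ t ∈ ({a, b, c, d} : Finset (Fin 8)), x ≠ t ∧ y ≠ t := fun t ht => by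
    have := hT ht
    simp at this; exact ⟨Ne.symm this.1, Ne.symm this.2⟩
  obtain ⟨xa, ya⟩ := nm a (by simp)
  obtain ⟨xb, yb⟩ := nm b (by simp)
  obtain ⟨xc, yc⟩ := nm c (by simp)
  obtain ⟨xd, yd⟩ := nm d (by simp)
  have q1 := hQ a b c d h1 h2 h3 h4 h5 h6
  have q2 := hQ x a b c xa xb xc h1 h2 h4
  have q3 := hQ x a b d xa xb xd h1 h3 h5
  have q4 := hQ x a c d xa xc xd h2 h3 h6
  have q5 := hQ x b c d xb xc xd h4 h5 h6
  have q6 := hQ y a b c ya yb yc h1 h2 h4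
  have q7 := hQ y a b d ya yb yd h1 h3 h5
  have q8 := hQ y a c d ya yc yd h2 h3 h6
  have q9 := hQ y b c d yb yc yd h4 h5 h6
  have r1 := hQ x y a b hxy xa xb ya yb h1
  have r2 := hQ x y a c hxy xa xc ya yc h2
  have r3 := hQ x y a d hxy xa xd ya yd h3
  have r4 := hQ x y b c hxy xb xc yb yc h4
  have r5 := hQ x y b d hxy xb xd yb yd h5
  have r6 := hQ x y c d hxy xc xd yc yd h6
  linarith

lemma Lpt_eq_span : Lpt = Submodule.span ℤ (Set.range fun p : Pr => vptZ {p.1.1, p.1.2}) := by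
  unfold Lpt
  congr 1
  ext w
  constructor
  · rintro ⟨i, j, h, rfl⟩
    rcases lt_or_gt_of_ne h with h | h
    · exact ⟨⟨(i, j), h⟩, rfl⟩
    · exact ⟨⟨(j, i), h⟩, by simp [Finset.pair_comm]⟩
  · rintro ⟨p, rfl⟩
    exact ⟨_, _, p.2.ne, rfl⟩

lemma sum_offdiag (C : Fin 8 → Fin 8 → ℤ) (hs : ∀ i j, C i j = C j i) (hd : ∀ i, C i i = 0) :
    ∑ i, ∑ j, C i j = 2 * ∑ p : Pr, C p.1.1 p.1.2 := by
  have e : ∑ p : Pr, C p.1.1 p.1.2 = ∑ i, ∑ j, if i < j then C i j else 0 := by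
    rw [← Fintype.sum_prod_type' (f := fun i j : Fin 8 => if i < j then C i j else 0),
      ← Finset.sum_filter]
    exact (Finset.sum_subtype _ (by simp) (fun p : Fin 8 × Fin 8 => C p.1 p.2)).symm
  have e2 : ∑ p : Pr, C p.1.1 p.1.2 = ∑ i, ∑ j, if j < i then C i j else 0 := by
    rw [e, Finset.sum_comm]
    simp only [hs]
  rw [two_mul]
  nth_rewrite 1 [e]
  rw [e2, ← Finset.sum_add_distrib]
  refine Finset.sum_congr rfl fun i _ => ?_
  rw [← Finset.sum_add_distrib]
  refine Finset.sum_congr rfl fun j _ => ?_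
  rcases lt_trichotomy i j with h | h | h
  · simp [h, h.not_gt]
  · subst h; simp [hd]
  · simp [h, h.not_gt]

lemma linInd : LinearIndependent ℤ fun p : Pr => vptZ {p.1.1, p.1.2} := by
  rw [Fintype.linearIndependent_iff]
  intro g hg
  let C : Fin 8 → Fin 8 → ℤ := fun i j =>
    if h : i < j then g ⟨(i, j), h⟩ else if h : j < i then g ⟨(j, i), h⟩ else 0
  have hs : ∀ i j, C i j = C j i := by
    intro i j
    rcases lt_trichotomy i j with h | h | h
    · simp [C, h, h.not_gt]
    · subst h; rfl
    · simp [C, h, h.not_gt]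
  have hd : ∀ i, C i i = 0 := by intro i; simp [C]
  have hC : ∀ p : Pr, C p.1.1 p.1.2 = g p := by intro p; simp [C, p.2]
  have hsum : ∀ Q : PIdx, ∑ i ∈ Q.1, ∑ j ∈ Q.1, C i j = 0 := by
    intro Q
    have h1 := congrFun hg Q
    have h2 := sum_offdiag (fun i j => C i j * (ind i Q * ind j Q))
      (fun i j => by rw [hs i j]; ring) (fun i => by rw [hd]; ring)
    simp only [Finset.sum_apply, Pi.smul_apply, smul_eq_mul, Pi.zero_apply] at h1
    have h3 : ∑ p : Pr, C p.1.1 p.1.2 * (ind p.1.1 Q * ind p.1.2 Q) = 0 := by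
      rw [← h1]
      refine Finset.sum_congr rfl fun p _ => ?_
      rw [hC, vptZ_eq p.2.ne]
    rw [h3, mul_zero] at h2
    rw [← h2, sum_ind]
    refine Finset.sum_congr rfl fun i _ => ?_
    rw [sum_ind, Finset.sum_mul]
    exact Finset.sum_congr rfl fun j _ => by ring
  intro p
  rw [← hC]
  refine pair_lin C hs ?_ _ _ p.2.ne
  intro a b c d h1 h2 h3 h4 h5 h6
  have na : a ∉ ({b, c, d} : Finset (Fin 8)) := by simp [*]
  have nb : b ∉ ({c, d} : Finset (Fin 8)) := by simp [*]
  have nc : c ∉ ({d} : Finset (Fin 8)) := by simp [*]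
  have := hsum ⟨{a, b, c, d}, by
    rw [Finset.card_insert_of_notMem na, Finset.card_insert_of_notMem nb,
      Finset.card_insert_of_notMem nc, Finset.card_singleton]⟩
  simp only [Finset.sum_insert na, Finset.sum_insert nb, Finset.sum_insert nc,
    Finset.sum_singleton, hd] at this
  linarith [hs a b, hs a c, hs a d, hs b c, hs b d, hs c d]

lemma finrank_Lpt : Module.finrank ℤ Lpt = 28 := by
  rw [Lpt_eq_span, finrank_span_eq_card linInd]
  decide +kernel

/-- The lattice `L` of additive Cayley relations has rank 42, the lattice
`L_pln` has rank 35, the lattice `L_pt` has rank 28, and `L = L_pln + L_pt`. -/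
theorem cayley_valuation_lattice :
    Module.finrank ℤ Lcayley = 42 ∧
    Module.finrank ℤ Lpln = 35 ∧
    Module.finrank ℤ Lpt = 28 ∧
    Lcayley = Lpln ⊔ Lpt := by
  exact ⟨finrank_L, finrank_Lpln, finrank_Lpt, L_eq⟩

end
end

section
/- (i) The three vectors max(v_ln^{CDE} + v_ln^{FGH}, v_pln^{CDEFGH}), max(v_pt^{AB}, v_pln^{ABCDE} + v_pln^{ABFGH}), and max(v_ln^{ABCDE} + v_ln^{CDE}, v_pt^{CDE}) — componentwise maxima — are pairwise PGL-equivalent valuation data (the χ_1^{AB|CDE|FGH} blocks). (ii) The three vectors v_ln^{DEFGH} + v_pln^{DEFGH}, v_ln^{ABC} + v_pt^{ABC}, and v_ln^{ABC} + v_pln^{DEFGH} are pairwise PGL-equivalent valuation data (the χ_2^{ABC} blocks). Moreover, every octad whose Plücker valuation vector is one of these vectors is carried by an element of GL_4(O_K̄) to an octad five of whose points are in standard position. -/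
open Finset

noncomputable section

/-- The point-coincidence vector `v_pt^T`, with `v_pt^T(Q) = max (0, |Q ∩ T| - 1)`. -/
def vpt (T : Finset (Fin 8)) : PIdx → ℚ := fun Q => max (((Q.1 ∩ T).card : ℚ) - 1) 0

/-- The line-coincidence vector `v_ln^T`, with `v_ln^T(Q) = max (0, |Q ∩ T| - 2)`. -/
def vln (T : Finset (Fin 8)) : PIdx → ℚ := fun Q => max (((Q.1 ∩ T).card : ℚ) - 2) 0

/-- The plane-coincidence vector `v_pln^T`, with `v_pln^T(Q) = max (0, |Q ∩ T| - 3)`. -/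
def vpln (T : Finset (Fin 8)) : PIdx → ℚ := fun Q => max (((Q.1 ∩ T).card : ℚ) - 3) 0

/-- An octad: an 8-tuple of points of `P³` given by coordinate vectors in `F⁴`. -/
abbrev Octad (F : Type) : Type := Fin 8 → Fin 4 → F

variable {F : Type} [Field F]

/-- The chosen affine representatives are normalized: every coordinate has valuation `≥ 0`
and the minimum coordinate valuation of every point is `0`. -/
def Normalized (v : AddValuation F (WithTop ℚ)) (O : Octad F) : Prop :=
  ∀ i, (∀ j, 0 ≤ v (O i j)) ∧ ∃ j, v (O i j) = 0

/-- The 4×4 matrix whose columns are the four points of the octad indexed by `Q`. -/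
def subMat (O : Octad F) (Q : PIdx) : Matrix (Fin 4) (Fin 4) F :=
  Matrix.of fun r c => O (Q.1.orderEmbOfFin Q.2 c) r

/-- `O` has Plücker valuation vector `w`, i.e. for every 4-element subset `Q` of the labels
the valuation of the corresponding Plücker coordinate is `w Q`. -/
def HasPluck (v : AddValuation F (WithTop ℚ)) (O : Octad F) (w : PIdx → ℚ) : Prop :=
  ∀ Q : PIdx, v ((subMat O Q).det) = ((w Q : ℚ) : WithTop ℚ)

/-- `O'` is obtained from `O` by a projective linear transformation of `P³`
(composed with a rescaling of the affine representative of each point). -/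
def PGLMove (O O' : Octad F) : Prop :=
  ∃ M : Matrix (Fin 4) (Fin 4) F, IsUnit M.det ∧
    ∃ c : Fin 8 → F, (∀ i, c i ≠ 0) ∧ ∀ i, O' i = c i • M.mulVec (O i)

/-- PGL-equivalence of valuation data: every octad with Plücker valuation vector `w` is
carried by some element of `PGL₄` to an octad with Plücker valuation vector `w'`, and
vice versa. -/
def PGLequiv (v : AddValuation F (WithTop ℚ)) (w w' : PIdx → ℚ) : Prop :=
  (∀ O : Octad F, Normalized v O → HasPluck v O w →
      ∃ O' : Octad F, Normalized v O' ∧ PGLMove O O' ∧ HasPluck v O' w') ∧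
  (∀ O : Octad F, Normalized v O → HasPluck v O w' →
      ∃ O' : Octad F, Normalized v O' ∧ PGLMove O O' ∧ HasPluck v O' w)

/-- A matrix with integral entries (valuations `≥ 0`). -/
def IntegralMat (v : AddValuation F (WithTop ℚ)) (M : Matrix (Fin 4) (Fin 4) F) : Prop :=
  ∀ i j, 0 ≤ v (M i j)

/-- An element of `GL₄(O)`: an invertible matrix with entries in the valuation ring whose
inverse also has entries in the valuation ring. -/
def GLIntegral (v : AddValuation F (WithTop ℚ)) (M : Matrix (Fin 4) (Fin 4) F) : Prop :=
  IntegralMat v M ∧ ∃ N, IntegralMat v N ∧ M * N = 1 ∧ N * M = 1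

/-- The five standard points `(1:0:0:0), (0:1:0:0), (0:0:1:0), (0:0:0:1), (1:1:1:1)`. -/
def stdFive : Fin 5 → Fin 4 → F :=
  ![![1, 0, 0, 0], ![0, 1, 0, 0], ![0, 0, 1, 0], ![0, 0, 0, 1], ![1, 1, 1, 1]]

/-- Five of the points of the octad are the five standard points of `P³`. -/
def FiveStandard (O : Octad F) : Prop :=
  ∃ ι : Fin 5 → Fin 8, Function.Injective ι ∧
    ∃ lam : Fin 5 → F, (∀ k, lam k ≠ 0) ∧ ∀ k, O (ι k) = lam k • stdFive k

/-- Every octad with Plücker valuation vector `w` is carried by an element of `GL₄(O)` to an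
octad five of whose points are the standard points. -/
def GLOStd (v : AddValuation F (WithTop ℚ)) (w : PIdx → ℚ) : Prop :=
  ∀ O : Octad F, Normalized v O → HasPluck v O w →
    ∃ M : Matrix (Fin 4) (Fin 4) F, GLIntegral v M ∧
      ∃ O' : Octad F, Normalized v O' ∧
        (∃ c : Fin 8 → F, (∀ i, c i ≠ 0) ∧ ∀ i, O' i = c i • M.mulVec (O i)) ∧
        FiveStandard O'

/-- The `χ₁^{AB|CDE|FGH}`-block valuation data (componentwise maxima). -/
def chi1a : PIdx → ℚ := (vln {2, 3, 4} + vln {5, 6, 7}) ⊔ vpln {2, 3, 4, 5, 6, 7}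
def chi1b : PIdx → ℚ := vpt {0, 1} ⊔ (vpln {0, 1, 2, 3, 4} + vpln {0, 1, 5, 6, 7})
def chi1c : PIdx → ℚ := (vln {0, 1, 2, 3, 4} + vln {2, 3, 4}) ⊔ vpt {2, 3, 4}

/-- The `χ₂^{ABC}`-block valuation data. -/
def chi2a : PIdx → ℚ := vln {3, 4, 5, 6, 7} + vpln {3, 4, 5, 6, 7}
def chi2b : PIdx → ℚ := vln {0, 1, 2} + vpt {0, 1, 2}
def chi2c : PIdx → ℚ := vln {0, 1, 2} + vpln {3, 4, 5, 6, 7}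

/-! ### Valuation helpers -/

theorem val_prod_eq (v : AddValuation F (WithTop ℚ)) {ι : Type} (s : Finset ι) (f : ι → F)
    (q : ι → ℚ) (h : ∀ i ∈ s, v (f i) = ((q i : ℚ) : WithTop ℚ)) :
    v (∏ i ∈ s, f i) = ((∑ i ∈ s, q i : ℚ) : WithTop ℚ) := by
  classical
  induction s using Finset.induction_on with
  | empty => simp
  | insert a s ha ih =>
    rw [Finset.prod_insert ha, Finset.sum_insert ha, AddValuation.map_mul,
      h a (Finset.mem_insert_self a s), ih (fun i hi => h i (Finset.mem_insert_of_mem hi))]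
    rfl

theorem val_mul_nonneg (v : AddValuation F (WithTop ℚ)) {x y : F} (hx : 0 ≤ v x) (hy : 0 ≤ v y) :
    0 ≤ v (x * y) := by
  rw [AddValuation.map_mul]; exact add_nonneg hx hy

theorem val_ne_zero (v : AddValuation F (WithTop ℚ)) {x : F} {q : ℚ}
    (h : v x = (q : WithTop ℚ)) : x ≠ 0 := by
  rintro rfl
  rw [AddValuation.map_zero] at h
  exact WithTop.top_ne_coe h

theorem val_inv_zero (v : AddValuation F (WithTop ℚ)) {x : F} (h : v x = 0) : v x⁻¹ = 0 := by
  have hx : x ≠ 0 := val_ne_zero v (q := 0) (by simpa using h)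
  have h1 : v (x * x⁻¹) = 0 := by rw [mul_inv_cancel₀ hx, AddValuation.map_one]
  rwa [AddValuation.map_mul, h, zero_add] at h1

theorem val_det_nonneg (v : AddValuation F (WithTop ℚ)) (M : Matrix (Fin 4) (Fin 4) F)
    (h : IntegralMat v M) : 0 ≤ v M.det := by
  rw [Matrix.det_apply']
  refine AddValuation.map_le_sum v fun σ _ => val_mul_nonneg v ?_ ?_
  · rcases Int.units_eq_one_or (Equiv.Perm.sign σ) with h | h <;> simp [h]
  · exact Finset.prod_induction _ (fun x => 0 ≤ v x) (fun _ _ => val_mul_nonneg v) (by simp)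
      (fun i _ => h _ _)

theorem integral_mul (v : AddValuation F (WithTop ℚ)) {M N : Matrix (Fin 4) (Fin 4) F}
    (hM : IntegralMat v M) (hN : IntegralMat v N) : IntegralMat v (M * N) := by
  intro i j
  rw [Matrix.mul_apply]
  exact AddValuation.map_le_sum v fun k _ => val_mul_nonneg v (hM _ _) (hN _ _)

theorem integral_diag (v : AddValuation F (WithTop ℚ)) {d : Fin 4 → F}
    (hd : ∀ i, 0 ≤ v (d i)) : IntegralMat v (Matrix.diagonal d) := by
  intro i j
  by_cases h : i = j
  · subst h; simpa using hd i
  · simp [h]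

theorem integral_adj (v : AddValuation F (WithTop ℚ)) {M : Matrix (Fin 4) (Fin 4) F}
    (hM : IntegralMat v M) : IntegralMat v M.adjugate := by
  intro i j
  rw [Matrix.adjugate_apply]
  refine val_det_nonneg v _ fun a b => ?_
  by_cases h : a = j
  · subst h
    rw [Matrix.updateRow_self]
    by_cases h2 : b = i
    · subst h2; simp
    · simp [h2]
  · rw [Matrix.updateRow_ne h]; exact hM _ _

/-! ### Plücker coordinates along arbitrary tuples -/

/-- The matrix with columns the points indexed by a tuple `f`. -/
def tupMat (O : Octad F) (f : Fin 4 → Fin 8) : Matrix (Fin 4) (Fin 4) F :=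
  Matrix.of fun r c => O (f c) r

/-- `n` represents `w` as a function on all finite sets. -/
def IntRep (w : PIdx → ℚ) (n : Finset (Fin 8) → ℤ) : Prop := ∀ Q : PIdx, w Q = (n Q.1 : ℚ)

theorem val_tup (v : AddValuation F (WithTop ℚ)) {O : Octad F} {w : PIdx → ℚ}
    {n : Finset (Fin 8) → ℤ} (hw : IntRep w n) (h : HasPluck v O w) (f : Fin 4 → Fin 8)
    (hf : Function.Injective f) :
    v (tupMat O f).det = (((n (univ.image f) : ℤ) : ℚ) : WithTop ℚ) := by
  have hc : (univ.image f).card = 4 := by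
    rw [Finset.card_image_of_injective _ hf]; simp
  have hQ := h ⟨univ.image f, hc⟩
  rw [hw] at hQ
  rw [← hQ]
  set g := (univ.image f).orderEmbOfFin hc with hg
  have hex : ∀ i, ∃ j, g j = f i := by
    intro i
    have : f i ∈ Set.range g := by
      rw [hg, Finset.range_orderEmbOfFin]; simp
    exact this
  choose σ hσ using hex
  have hσi : Function.Injective σ := by
    intro a b hab
    apply hf
    rw [← hσ, ← hσ, hab]
  let τ : Equiv.Perm (Fin 4) := Equiv.ofBijective σ (Finite.injective_iff_bijective.mp hσi)
  have hm : tupMat O f = (subMat O ⟨univ.image f, hc⟩).submatrix id τ := by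
    ext r c
    simp only [tupMat, subMat, Matrix.submatrix_apply, Matrix.of_apply, id]
    rw [← hσ c]; rfl
  rw [hm, Matrix.det_permute']
  rcases Int.units_eq_one_or (Equiv.Perm.sign τ) with h | h <;> simp [h]

theorem adj_mulVec (O : Octad F) (B : Fin 4 → Fin 8) (X : Fin 8) (k : Fin 4) :
    ((tupMat O B).adjugate.mulVec (O X)) k = (tupMat O (Function.update B k X)).det := by
  rw [← Matrix.cramer_eq_adjugate_mulVec, Matrix.cramer_apply]
  congr 1
  ext r c
  by_cases h : c = k
  · subst h; simp [tupMat]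
  · simp [tupMat, h]

theorem tup_det_zero (O : Octad F) (f : Fin 4 → Fin 8) (hf : ¬ Function.Injective f) :
    (tupMat O f).det = 0 := by
  simp only [Function.Injective, not_forall] at hf
  obtain ⟨a, b, hab, hne⟩ := hf
  exact Matrix.det_zero_of_column_eq hne (fun r => by simp [tupMat, hab])

/-- The combinatorial condition under which a diagonal change of basis along `B` normalizes. -/
def Good (n : Finset (Fin 8) → ℤ) (B : Fin 4 → Fin 8) (a : Fin 8 → ℤ) : Prop :=
  Function.Injective B ∧ n (univ.image B) = 0 ∧
  (∀ X k, Function.Injective (Function.update B k X) →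
    0 ≤ a X + (-a (B k) + n (univ.image (Function.update B k X)))) ∧
  (∀ X, ∃ k, Function.Injective (Function.update B k X) ∧
    a X + (-a (B k) + n (univ.image (Function.update B k X))) = 0)

instance (n : Finset (Fin 8) → ℤ) (B : Fin 4 → Fin 8) (a : Fin 8 → ℤ) :
    Decidable (Good n B a) := by unfold Good; infer_instance

theorem norm_move (v : AddValuation F (WithTop ℚ)) {O : Octad F} {w : PIdx → ℚ}
    {n : Finset (Fin 8) → ℤ} (hw : IntRep w n) (h : HasPluck v O w) {B : Fin 4 → Fin 8}
    {a : Fin 8 → ℤ} (hG : Good n B a) (c : Fin 8 → F) (d : Fin 4 → F)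
    (hc : ∀ X, v (c X) = ((a X : ℚ) : WithTop ℚ))
    (hd : ∀ k, v (d k) = (((-a (B k) : ℤ) : ℚ) : WithTop ℚ)) :
    Normalized v (fun X => c X • (Matrix.diagonal d * (tupMat O B).adjugate).mulVec (O X)) := by
  have key : ∀ X k, (c X • (Matrix.diagonal d * (tupMat O B).adjugate).mulVec (O X)) k
      = c X * (d k * (tupMat O (Function.update B k X)).det) := by
    intro X k
    rw [← Matrix.mulVec_mulVec, Pi.smul_apply, Matrix.mulVec_diagonal, adj_mulVec, smul_eq_mul]
  have kv : ∀ X k, Function.Injective (Function.update B k X) →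
      v (c X * (d k * (tupMat O (Function.update B k X)).det)) =
      (((a X + (-a (B k) + n (univ.image (Function.update B k X))) : ℤ) : ℚ) : WithTop ℚ) := by
    intro X k hi
    rw [AddValuation.map_mul, AddValuation.map_mul, hc, hd, val_tup v hw h _ hi]
    push_cast
    rfl
  obtain ⟨-, -, h1, h2⟩ := hG
  intro X
  simp only [key]
  constructor
  · intro k
    by_cases hi : Function.Injective (Function.update B k X)
    · rw [kv X k hi]
      exact_mod_cast h1 X k hi
    · rw [tup_det_zero _ _ hi]; simp
  · obtain ⟨k, hi, hk⟩ := h2 X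
    refine ⟨k, ?_⟩
    rw [kv X k hi, hk]; simp

theorem half_move (v : AddValuation F (WithTop ℚ))
    (hsurj : ∀ q : ℚ, ∃ x : F, v x = (q : WithTop ℚ)) {w w' : PIdx → ℚ}
    {n n' : Finset (Fin 8) → ℤ} (hw : IntRep w n) (hw' : IntRep w' n') {B : Fin 4 → Fin 8}
    {a : Fin 8 → ℤ} (hG : Good n B a)
    (hdiff : ∀ Q : Finset (Fin 8), Q.card = 4 →
      n' Q = n Q + ∑ k, (-a (B k)) + ∑ i ∈ Q, a i) :
    ∀ O : Octad F, Normalized v O → HasPluck v O w →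
      ∃ O' : Octad F, Normalized v O' ∧ PGLMove O O' ∧ HasPluck v O' w' := by
  intro O _ hP
  choose c hc using fun X => hsurj (a X : ℚ)
  choose d hd using fun k => hsurj (((-a (B k) : ℤ) : ℚ))
  have hdet : v (tupMat O B).det = 0 := by
    rw [val_tup v hw hP B hG.1, hG.2.1]; simp
  have hdet0 : (tupMat O B).det ≠ 0 := val_ne_zero v (q := 0) (by simpa using hdet)
  have hadj : v (tupMat O B).adjugate.det = 0 := by
    rw [Matrix.det_adjugate, AddValuation.map_pow, hdet]; simp
  have hprod := val_prod_eq v univ d (fun k => ((-a (B k) : ℤ) : ℚ)) (fun k _ => hd k)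
  have hM : v (Matrix.diagonal d * (tupMat O B).adjugate).det
      = ((∑ k, ((-a (B k) : ℤ) : ℚ) : ℚ) : WithTop ℚ) := by
    rw [Matrix.det_mul, Matrix.det_diagonal, AddValuation.map_mul, hadj, add_zero, hprod]
  refine ⟨_, norm_move v hw hP hG c d hc hd,
    ⟨Matrix.diagonal d * (tupMat O B).adjugate, ?_, c, fun i => val_ne_zero v (hc i),
      fun i => rfl⟩, ?_⟩
  · exact isUnit_iff_ne_zero.mpr (val_ne_zero v hM)
  · intro Q
    set M := Matrix.diagonal d * (tupMat O B).adjugate with hMdef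
    have hs : subMat (fun X => c X • M.mulVec (O X)) Q
        = M * subMat O Q * Matrix.diagonal (fun k => c (Q.1.orderEmbOfFin Q.2 k)) := by
      ext r k
      rw [Matrix.mul_diagonal]
      simp only [subMat, Matrix.of_apply, Pi.smul_apply, smul_eq_mul, Matrix.mul_apply,
        Matrix.mulVec, dotProduct]
      ring
    have hsum : ∑ k, a (Q.1.orderEmbOfFin Q.2 k) = ∑ i ∈ Q.1, a i := by
      conv_rhs => rw [← Finset.image_orderEmbOfFin_univ Q.1 Q.2]
      rw [Finset.sum_image]
      intro x _ y _ hxy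
      exact (Q.1.orderEmbOfFin Q.2).injective hxy
    rw [hs, Matrix.det_mul, Matrix.det_mul, Matrix.det_diagonal, AddValuation.map_mul,
      AddValuation.map_mul, hM, hP Q,
      val_prod_eq v univ _ (fun k => (a (Q.1.orderEmbOfFin Q.2 k) : ℚ)) (fun k _ => hc _),
      hw, hw', hdiff Q.1 Q.2, ← hsum]
    rw [← WithTop.coe_add, ← WithTop.coe_add]
    congr 1
    push_cast
    ring

theorem gl_std (v : AddValuation F (WithTop ℚ)) {w : PIdx → ℚ}
    {n : Finset (Fin 8) → ℤ} (hw : IntRep w n) (B : Fin 4 → Fin 8) (Y : Fin 8)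
    (hG : Good n B (fun _ => 0))
    (hY : (∀ k, B k ≠ Y) ∧ ∀ k, Function.Injective (Function.update B k Y) ∧
      n (univ.image (Function.update B k Y)) = 0) : GLOStd v w := by
  intro O hN hP
  have hdet : v (tupMat O B).det = 0 := by
    rw [val_tup v hw hP B hG.1, hG.2.1]; simp
  have hdet0 : (tupMat O B).det ≠ 0 := val_ne_zero v (q := 0) (by simpa using hdet)
  set e : Fin 4 → F := fun k => (tupMat O (Function.update B k Y)).det with he
  have hev : ∀ k, v (e k) = 0 := by
    intro k
    rw [he]
    simp only
    rw [val_tup v hw hP _ (hY.2 k).1, (hY.2 k).2]; simp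
  have he0 : ∀ k, e k ≠ 0 := fun k => val_ne_zero v (q := 0) (by simpa using hev k)
  set d : Fin 4 → F := fun k => (e k)⁻¹ with hd
  have hdv : ∀ k, v (d k) = 0 := fun k => val_inv_zero v (hev k)
  have hint : IntegralMat v (tupMat O B) := fun i j => (hN _).1 _
  have hMN : (Matrix.diagonal d * (tupMat O B).adjugate) *
      (tupMat O B * Matrix.diagonal (fun k => (tupMat O B).det⁻¹ * e k)) = 1 := by
    calc _ = Matrix.diagonal d * ((tupMat O B).adjugate * tupMat O B) *
          Matrix.diagonal (fun k => (tupMat O B).det⁻¹ * e k) := by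
            simp only [Matrix.mul_assoc]
      _ = 1 := by
        rw [Matrix.adjugate_mul, Matrix.mul_smul, Matrix.mul_one, Matrix.smul_mul,
          Matrix.diagonal_mul_diagonal, ← Matrix.diagonal_smul, ← Matrix.diagonal_one]
        congr 1
        funext k
        have := he0 k
        simp only [Pi.smul_apply, smul_eq_mul, hd]
        field_simp
  refine ⟨Matrix.diagonal d * (tupMat O B).adjugate, ⟨?_, _, ?_, hMN, ?_⟩, _,
    norm_move v hw hP hG (fun _ => 1) d (by simp) (by simpa using hdv),
    ⟨fun _ => 1, by simp, fun i => rfl⟩, ?_⟩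
  · exact integral_mul v (integral_diag v fun k => (hdv k).ge) (integral_adj v hint)
  · refine integral_mul v hint (integral_diag v fun k => val_mul_nonneg v ?_ (hev k).ge)
    exact (val_inv_zero v hdet).ge
  · exact mul_eq_one_comm.mp hMN
  · have hval : ∀ X k, ((Matrix.diagonal d * (tupMat O B).adjugate).mulVec (O X)) k
        = d k * (tupMat O (Function.update B k X)).det := by
      intro X k
      rw [← Matrix.mulVec_mulVec, Matrix.mulVec_diagonal, adj_mulVec]
    have hcoord : ∀ k, (Matrix.diagonal d * (tupMat O B).adjugate).mulVec (O (B k))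
        = fun j => if j = k then d k * (tupMat O B).det else 0 := by
      intro k
      funext j
      rw [hval]
      by_cases hjk : j = k
      · subst hjk; simp
      · rw [if_neg hjk, tup_det_zero, mul_zero]
        intro hi
        apply hjk
        apply hi
        rw [Function.update_self, Function.update_of_ne (Ne.symm hjk)]
    have hlast : (Matrix.diagonal d * (tupMat O B).adjugate).mulVec (O Y) = fun _ => 1 := by
      funext j
      rw [hval]
      exact inv_mul_cancel₀ (he0 j)
    refine ⟨![B 0, B 1, B 2, B 3, Y], ?_,
      ![d 0 * (tupMat O B).det, d 1 * (tupMat O B).det, d 2 * (tupMat O B).det,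
        d 3 * (tupMat O B).det, 1], ?_, ?_⟩
    · have hB := hG.1
      have hYn := hY.1
      intro i j hij
      fin_cases i <;> fin_cases j <;> first
        | rfl
        | exact absurd hij (hYn _)
        | exact absurd hij.symm (hYn _)
        | exact absurd (hB hij) (by decide)
    · have hd0 : ∀ k, d k * (tupMat O B).det ≠ 0 :=
        fun k => mul_ne_zero (inv_ne_zero (he0 k)) hdet0
      intro k
      fin_cases k
      · exact hd0 0
      · exact hd0 1
      · exact hd0 2
      · exact hd0 3
      · exact one_ne_zero
    · intro k
      beta_reduce
      rw [one_smul]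
      fin_cases k
      · refine (hcoord 0).trans ?_
        funext j; fin_cases j <;> simp [stdFive]
      · refine (hcoord 1).trans ?_
        funext j; fin_cases j <;> simp [stdFive]
      · refine (hcoord 2).trans ?_
        funext j; fin_cases j <;> simp [stdFive]
      · refine (hcoord 3).trans ?_
        funext j; fin_cases j <;> simp [stdFive]
      · refine hlast.trans ?_
        funext j; fin_cases j <;> simp [stdFive]

theorem PGLMove_trans {O O' O'' : Octad F} (h : PGLMove O O') (h' : PGLMove O' O'') :
    PGLMove O O'' := by
  obtain ⟨M, hM, c, hc, e⟩ := h
  obtain ⟨M', hM', c', hc', e'⟩ := h'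
  refine ⟨M' * M, by rw [Matrix.det_mul]; exact hM'.mul hM, fun i => c' i * c i,
    fun i => mul_ne_zero (hc' i) (hc i), fun i => ?_⟩
  rw [e', e, Matrix.mulVec_smul, Matrix.mulVec_mulVec, smul_smul]

theorem PGLequiv_trans {v : AddValuation F (WithTop ℚ)} {w w' w'' : PIdx → ℚ}
    (h : PGLequiv v w w') (h' : PGLequiv v w' w'') : PGLequiv v w w'' := by
  constructor
  · intro O hN hP
    obtain ⟨O1, hN1, hm1, hP1⟩ := h.1 O hN hP
    obtain ⟨O2, hN2, hm2, hP2⟩ := h'.1 O1 hN1 hP1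
    exact ⟨O2, hN2, PGLMove_trans hm1 hm2, hP2⟩
  · intro O hN hP
    obtain ⟨O1, hN1, hm1, hP1⟩ := h'.2 O hN hP
    obtain ⟨O2, hN2, hm2, hP2⟩ := h.2 O1 hN1 hP1
    exact ⟨O2, hN2, PGLMove_trans hm1 hm2, hP2⟩

theorem PGLequiv_symm {v : AddValuation F (WithTop ℚ)} {w w' : PIdx → ℚ}
    (h : PGLequiv v w w') : PGLequiv v w' w := ⟨h.2, h.1⟩

theorem equiv_of_good (v : AddValuation F (WithTop ℚ))
    (hsurj : ∀ q : ℚ, ∃ x : F, v x = (q : WithTop ℚ)) {w w' : PIdx → ℚ}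
    {n n' : Finset (Fin 8) → ℤ} (hw : IntRep w n) (hw' : IntRep w' n') (B : Fin 4 → Fin 8)
    (a : Fin 8 → ℤ) (hG : Good n B a) (hG' : Good n' B (fun i => -a i))
    (hdiff : ∀ Q : Finset (Fin 8), Q.card = 4 →
      n' Q = n Q + ∑ k, (-a (B k)) + ∑ i ∈ Q, a i) : PGLequiv v w w' := by
  refine ⟨half_move v hsurj hw hw' hG hdiff, half_move v hsurj hw' hw hG' fun Q hQ => ?_⟩
  rw [hdiff Q hQ]
  simp only [Finset.sum_neg_distrib]
  ring

/-! ### The integral versions of the block vectors -/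

/-- Truncated count `max (|Q ∩ T| - m) 0`. -/
def nv (m : ℤ) (T Q : Finset (Fin 8)) : ℤ := max (((Q ∩ T).card : ℤ) - m) 0

def n1a (Q : Finset (Fin 8)) : ℤ :=
  max (nv 2 {2, 3, 4} Q + nv 2 {5, 6, 7} Q) (nv 3 {2, 3, 4, 5, 6, 7} Q)
def n1b (Q : Finset (Fin 8)) : ℤ :=
  max (nv 1 {0, 1} Q) (nv 3 {0, 1, 2, 3, 4} Q + nv 3 {0, 1, 5, 6, 7} Q)
def n1c (Q : Finset (Fin 8)) : ℤ :=
  max (nv 2 {0, 1, 2, 3, 4} Q + nv 2 {2, 3, 4} Q) (nv 1 {2, 3, 4} Q)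
def n2a (Q : Finset (Fin 8)) : ℤ := nv 2 {3, 4, 5, 6, 7} Q + nv 3 {3, 4, 5, 6, 7} Q
def n2b (Q : Finset (Fin 8)) : ℤ := nv 2 {0, 1, 2} Q + nv 1 {0, 1, 2} Q
def n2c (Q : Finset (Fin 8)) : ℤ := nv 2 {0, 1, 2} Q + nv 3 {3, 4, 5, 6, 7} Q

theorem rep1a : IntRep chi1a n1a := fun Q => by
  simp [chi1a, n1a, nv, vln, vpln]
theorem rep1b : IntRep chi1b n1b := fun Q => by
  simp [chi1b, n1b, nv, vpt, vpln, max_assoc]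
theorem rep1c : IntRep chi1c n1c := fun Q => by
  simp [chi1c, n1c, nv, vln, vpt]
theorem rep2a : IntRep chi2a n2a := fun Q => by
  simp [chi2a, n2a, nv, vln, vpln]
theorem rep2b : IntRep chi2b n2b := fun Q => by
  simp [chi2b, n2b, nv, vln, vpt]
theorem rep2c : IntRep chi2c n2c := fun Q => by
  simp [chi2c, n2c, nv, vln, vpln]

/-- (i) The three `χ₁^{AB|CDE|FGH}`-block valuation data are pairwise
PGL-equivalent; (ii) the three `χ₂^{ABC}`-block valuation data are pairwise PGL-equivalent.
Moreover, every octad with one of these Plücker valuation vectors is carried by an element of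
`GL₄(O)` to an octad five of whose points are in standard position.
(Labels: `A,…,H = 0,…,7`.) -/
theorem chi_blocks_PGL_equivalent
    (F : Type) [Field F] [IsAlgClosed F] (v : AddValuation F (WithTop ℚ))
    (hsurj : ∀ q : ℚ, ∃ x : F, v x = (q : WithTop ℚ))
    (hres : v 2 = 0) :
    PGLequiv v chi1a chi1b ∧ PGLequiv v chi1b chi1c ∧ PGLequiv v chi1a chi1c ∧
    PGLequiv v chi2a chi2b ∧ PGLequiv v chi2b chi2c ∧ PGLequiv v chi2a chi2c ∧
    GLOStd v chi1a ∧ GLOStd v chi1b ∧ GLOStd v chi1c ∧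
    GLOStd v chi2a ∧ GLOStd v chi2b ∧ GLOStd v chi2c := by
  have e1ab : PGLequiv v chi1a chi1b :=
    equiv_of_good v hsurj rep1a rep1b ![0, 2, 3, 5] ![1, 1, 0, 0, 0, 0, 0, 0]
      (by decide +kernel) (by decide +kernel) (by decide +kernel)
  have e1bc : PGLequiv v chi1b chi1c :=
    equiv_of_good v hsurj rep1b rep1c ![0, 2, 5, 6] ![0, 0, 1, 1, 1, 0, 0, 0]
      (by decide +kernel) (by decide +kernel) (by decide +kernel)
  have e2ac : PGLequiv v chi2a chi2c :=
    equiv_of_good v hsurj rep2a rep2c ![0, 1, 3, 4] ![0, 0, 0, -1, -1, -1, -1, -1]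
      (by decide +kernel) (by decide +kernel) (by decide +kernel)
  have e2cb : PGLequiv v chi2c chi2b :=
    equiv_of_good v hsurj rep2c rep2b ![0, 3, 4, 5] ![0, 0, 0, -1, -1, -1, -1, -1]
      (by decide +kernel) (by decide +kernel) (by decide +kernel)
  refine ⟨e1ab, e1bc, PGLequiv_trans e1ab e1bc, PGLequiv_trans e2ac e2cb, PGLequiv_symm e2cb,
    e2ac, ?_, ?_, ?_, ?_, ?_, ?_⟩
  · exact gl_std v rep1a ![0, 1, 2, 3] 5 (by decide +kernel) (by decide +kernel)
  · exact gl_std v rep1b ![0, 2, 3, 5] 6 (by decide +kernel) (by decide +kernel)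
  · exact gl_std v rep1c ![0, 2, 5, 6] 7 (by decide +kernel) (by decide +kernel)
  · exact gl_std v rep2a ![0, 1, 2, 3] 4 (by decide +kernel) (by decide +kernel)
  · exact gl_std v rep2b ![0, 3, 4, 5] 6 (by decide +kernel) (by decide +kernel)
  · exact gl_std v rep2c ![0, 1, 3, 4] 5 (by decide +kernel) (by decide +kernel)

end
end

section
/- The vectors v_ln^{ABCD} and v_ln^{EFGH} are PGL-equivalent valuation data. Moreover, every octad whose Plücker valuation vector is one of these vectors is carried by an element of GL_4(O_K̄) to an octad five of whose points are in standard position. -/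
open Finset

noncomputable section

variable {F : Type} [Field F]

section Aux

variable {v : AddValuation F (WithTop ℚ)}

theorem aux_v_sum_nonneg {ι : Type} (s : Finset ι) (f : ι → F) (h : ∀ i ∈ s, 0 ≤ v (f i)) :
    0 ≤ v (∑ i ∈ s, f i) := AddValuation.map_le_sum v h

theorem aux_v_mul_nonneg {x y : F} (hx : 0 ≤ v x) (hy : 0 ≤ v y) : 0 ≤ v (x * y) := by
  rw [v.map_mul]; exact add_nonneg hx hy

theorem aux_v_prod_nonneg {ι : Type} (s : Finset ι) (f : ι → F) (h : ∀ i ∈ s, 0 ≤ v (f i)) :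
    0 ≤ v (∏ i ∈ s, f i) := by
  refine Finset.prod_induction f (fun x => 0 ≤ v x) (fun a b => aux_v_mul_nonneg) ?_ h
  rw [v.map_one]

theorem aux_v_sign (σ : Equiv.Perm (Fin 4)) : v ((Equiv.Perm.sign σ : ℤ) : F) = 0 := by
  rcases Int.units_eq_one_or (Equiv.Perm.sign σ) with h | h <;> rw [h] <;> simp

theorem aux_v_det_nonneg (M : Matrix (Fin 4) (Fin 4) F) (h : IntegralMat v M) :
    0 ≤ v M.det := by
  rw [Matrix.det_apply']
  refine aux_v_sum_nonneg _ _ fun σ _ => aux_v_mul_nonneg ?_ ?_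
  · rw [aux_v_sign]
  · exact aux_v_prod_nonneg _ _ fun i _ => h _ _

theorem aux_ne_zero {x : F} {q : ℚ} (h : v x = (q : WithTop ℚ)) : x ≠ 0 := by
  rintro rfl
  rw [v.map_zero] at h
  exact WithTop.top_ne_coe h

theorem aux_ne_zero' {x : F} (h : v x = 0) : x ≠ 0 := by
  rintro rfl
  rw [v.map_zero] at h
  exact WithTop.top_ne_coe (a := (0:ℚ)) h

theorem aux_v_inv {x : F} (h : v x = 0) : v x⁻¹ = 0 := by
  have h1 : v (x * x⁻¹) = 0 := by rw [mul_inv_cancel₀ (aux_ne_zero' h), v.map_one]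
  rw [v.map_mul, h, zero_add] at h1
  exact h1

theorem aux_pluck {T : Finset (Fin 8)} {O : Octad F} (h : HasPluck v O (vln T))
    (s : Fin 4 → Fin 8) (hs : Function.Injective s) :
    v (Matrix.of fun r c => O (s c) r).det =
      ((max (((if s 0 ∈ T then 1 else 0) + (if s 1 ∈ T then 1 else 0) +
        (if s 2 ∈ T then 1 else 0) + (if s 3 ∈ T then 1 else 0) : ℚ) - 2) 0 : ℚ) : WithTop ℚ) := by
  have hQ : (univ.image s).card = 4 := by rw [card_image_of_injective _ hs]; simp
  have hval : vln T ⟨univ.image s, hQ⟩ = max (((if s 0 ∈ T then 1 else 0) + (if s 1 ∈ T then 1 else 0) +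
        (if s 2 ∈ T then 1 else 0) + (if s 3 ∈ T then 1 else 0) : ℚ) - 2) 0 := by
    unfold vln
    congr 2
    rw [← Finset.filter_mem_eq_inter, Finset.card_filter, Finset.sum_image hs.injOn,
      Fin.sum_univ_four]
    push_cast
    rfl
  rw [← hval, ← h ⟨univ.image s, hQ⟩]
  set e := (univ.image s).orderEmbOfFin hQ with he
  have hr : ∀ k, ∃ j, e j = s k := by
    intro k
    have : s k ∈ Set.range e := by rw [he, Finset.range_orderEmbOfFin]; simp
    exact this
  choose σ hσ using hr
  have hσi : Function.Injective σ := by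
    intro a b hab
    apply hs
    rw [← hσ a, ← hσ b, hab]
  let τ : Equiv.Perm (Fin 4) := Equiv.ofBijective σ (Finite.injective_iff_bijective.1 hσi)
  have hm : (Matrix.of fun r c => O (s c) r) = (subMat O ⟨univ.image s, hQ⟩).submatrix id τ := by
    ext r c
    simp only [Matrix.submatrix_apply, subMat, Matrix.of_apply, id]
    rw [← hσ c]
    rfl
  rw [hm, Matrix.det_permute', v.map_mul, aux_v_sign, zero_add]

theorem aux_pluck' {T : Finset (Fin 8)} {O : Octad F} (h : HasPluck v O (vln T))
    (m : ℚ) (s : Fin 4 → Fin 8) (hs : Function.Injective s)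
    (hm : max (((if s 0 ∈ T then 1 else 0) + (if s 1 ∈ T then 1 else 0) +
        (if s 2 ∈ T then 1 else 0) + (if s 3 ∈ T then 1 else 0) : ℚ) - 2) 0 = m) :
    v (Matrix.of fun r c => O (s c) r).det = (m : WithTop ℚ) := by
  rw [aux_pluck h s hs, hm]

theorem aux_norm {O : Octad F} (hO : Normalized v O) {M : Matrix (Fin 4) (Fin 4) F}
    (hM : GLIntegral v M) : Normalized v (fun i => M.mulVec (O i)) := by
  obtain ⟨hM, N, hN, -, hNM⟩ := hM
  intro i
  have hpos : ∀ j, 0 ≤ v (M.mulVec (O i) j) := fun j => by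
    rw [Matrix.mulVec, dotProduct]
    exact aux_v_sum_nonneg _ _ fun k _ => aux_v_mul_nonneg (hM _ _) ((hO i).1 k)
  refine ⟨hpos, ?_⟩
  by_contra hcon
  push Not at hcon
  obtain ⟨j, hj⟩ := (hO i).2
  have h1 : O i = N.mulVec (M.mulVec (O i)) := by
    rw [Matrix.mulVec_mulVec, hNM, Matrix.one_mulVec]
  have h2 : 0 < v (O i j) := by
    rw [h1, Matrix.mulVec, dotProduct]
    refine AddValuation.map_lt_sum v (WithTop.coe_ne_top (a := (0 : ℚ))) fun k _ => ?_
    rw [v.map_mul]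
    exact lt_of_lt_of_le (lt_of_le_of_ne (hpos k) (Ne.symm (hcon k)))
      (le_add_of_nonneg_left (hN j k))
  exact absurd hj h2.ne'

/-- The matrix with columns the points `a b e f`. -/
def aux_B (O : Octad F) (s : Fin 4 → Fin 8) : Matrix (Fin 4) (Fin 4) F :=
  Matrix.of fun r c => O (s c) r

theorem aux_inv {B : Matrix (Fin 4) (Fin 4) F} (hB : IntegralMat v B) (hd : v B.det = 0) :
    GLIntegral v B⁻¹ := by
  have hu : IsUnit B.det := isUnit_iff_ne_zero.2 (aux_ne_zero' hd)
  refine ⟨?_, B, hB, Matrix.nonsing_inv_mul _ hu, Matrix.mul_nonsing_inv _ hu⟩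
  intro i j
  rw [Matrix.inv_def, Matrix.smul_apply, Ring.inverse_eq_inv', smul_eq_mul]
  refine aux_v_mul_nonneg (aux_v_inv hd).ge ?_
  rw [Matrix.adjugate_apply]
  refine aux_v_det_nonneg _ fun k l => ?_
  rw [Matrix.updateRow_apply]
  split_ifs
  · by_cases h : l = i
    · subst h; simp
    · simp [h]
  · exact hB _ _

theorem aux_coord {O : Octad F} {s : Fin 4 → Fin 8} (hd : v (aux_B O s).det = 0)
    (i : Fin 8) (r : Fin 4) :
    v (((aux_B O s)⁻¹.mulVec (O i)) r) =
      v (Matrix.of fun r' c => O (Function.update s r i c) r').det := by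
  rw [Matrix.inv_def, Matrix.smul_mulVec, ← Matrix.cramer_eq_adjugate_mulVec, Pi.smul_apply,
    smul_eq_mul, v.map_mul, Ring.inverse_eq_inv', aux_v_inv hd, zero_add, Matrix.cramer_apply]
  congr 2
  ext r' c
  by_cases h : c = r
  · subst h; simp
  · simp [h, aux_B]

theorem aux_col {O : Octad F} {s : Fin 4 → Fin 8} (hd : v (aux_B O s).det = 0) (k : Fin 4) :
    (aux_B O s)⁻¹.mulVec (O (s k)) = Pi.single k 1 := by
  have hu : IsUnit (aux_B O s).det := isUnit_iff_ne_zero.2 (aux_ne_zero' hd)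
  have : O (s k) = (aux_B O s).mulVec (Pi.single k 1) := by
    rw [Matrix.mulVec_single_one]; rfl
  rw [this, Matrix.mulVec_mulVec, Matrix.nonsing_inv_mul _ hu, Matrix.one_mulVec]

theorem aux_diag {d : Fin 4 → F} (h : ∀ i, v (d i) = 0) :
    GLIntegral v (Matrix.diagonal d) := by
  have key : ∀ d : Fin 4 → F, (∀ i, v (d i) = 0) → IntegralMat v (Matrix.diagonal d) := by
    intro d h i j
    rw [Matrix.diagonal_apply]
    split_ifs
    · rw [h]
    · simp
  refine ⟨key d h, Matrix.diagonal (fun i => (d i)⁻¹), key _ fun i => aux_v_inv (h i), ?_, ?_⟩ <;>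
  · rw [Matrix.diagonal_mul_diagonal, ← Matrix.diagonal_one]
    congr 1
    ext i
    have := aux_ne_zero' (h i)
    field_simp

theorem aux_intmul {M N : Matrix (Fin 4) (Fin 4) F} (hM : IntegralMat v M)
    (hN : IntegralMat v N) : IntegralMat v (M * N) := fun i j => by
  rw [Matrix.mul_apply]
  exact aux_v_sum_nonneg _ _ fun k _ => aux_v_mul_nonneg (hM _ _) (hN _ _)

theorem aux_glmul {M N : Matrix (Fin 4) (Fin 4) F} (hM : GLIntegral v M)
    (hN : GLIntegral v N) : GLIntegral v (M * N) := by
  obtain ⟨hM, M', hM', h1, h2⟩ := hM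
  obtain ⟨hN, N', hN', h3, h4⟩ := hN
  refine ⟨aux_intmul hM hN, N' * M', aux_intmul hN' hM', ?_, ?_⟩
  · rw [Matrix.mul_assoc, ← Matrix.mul_assoc N, h3, Matrix.one_mul, h1]
  · rw [Matrix.mul_assoc, ← Matrix.mul_assoc M', h2, Matrix.one_mul, h4]

theorem aux_det {T : Finset (Fin 8)} {O : Octad F} (h : HasPluck v O (vln T))
    {a b e f : Fin 8} (hs : Function.Injective ![a, b, e, f])
    (ha : a ∈ T) (hb : b ∈ T) (he : e ∉ T) (hf : f ∉ T) :
    v (aux_B O ![a, b, e, f]).det = 0 := by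
  unfold aux_B
  refine aux_pluck' h 0 _ hs ?_
  simp [ha, hb, he, hf] <;> norm_num

theorem aux_GLOStd {T : Finset (Fin 8)} {a b e f g : Fin 8}
    (hs : Function.Injective ![a, b, e, f, g])
    (ha : a ∈ T) (hb : b ∈ T) (he : e ∉ T) (hf : f ∉ T) (hg : g ∉ T) :
    GLOStd v (vln T) := by
  intro O hO h
  have hs4 : Function.Injective ![a, b, e, f] := by
    intro x y hxy
    have : ∀ k : Fin 4, ![a, b, e, f] k = ![a, b, e, f, g] k.castSucc := by
      intro k; fin_cases k <;> rfl
    rw [this, this] at hxy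
    exact Fin.castSucc_injective _ (hs hxy)
  have hd := aux_det h hs4 ha hb he hf
  set s := ![a, b, e, f] with hsdef
  have hB : IntegralMat v (aux_B O s) := fun i j => (hO _).1 _
  have hN := aux_inv hB hd
  set N := (aux_B O s)⁻¹ with hNdef
  have hgs : ∀ k, g ≠ s k := by
    intro k hk
    have : ![a, b, e, f, g] (Fin.last 4) = ![a, b, e, f, g] k.castSucc := by
      refine Eq.trans (b := g) rfl (hk.trans ?_)
      fin_cases k <;> rfl
    exact (Fin.castSucc_lt_last k).ne' (hs this)
  have hunit : ∀ r, v (N.mulVec (O g) r) = 0 := by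
    intro r
    rw [hNdef, aux_coord hd]
    refine aux_pluck' h 0 _ ?_ ?_
    rotate_left
    · fin_cases r <;> simp [ha, hb, he, hf, hg, hsdef, Function.update] <;> norm_num
    · intro x y hxy
      simp only [Function.update_apply] at hxy
      split_ifs at hxy with h1 h2 h2
      · rw [h1, h2]
      · exact absurd hxy (hgs _)
      · exact absurd hxy.symm (hgs _)
      · exact hs4 hxy
  set u := N.mulVec (O g) with hu
  have hM : GLIntegral v (Matrix.diagonal (fun i => (u i)⁻¹) * N) :=
    aux_glmul (aux_diag fun i => aux_v_inv (hunit i)) hN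
  have hu0 : ∀ r, u r ≠ 0 := fun r => aux_ne_zero' (hunit r)
  refine ⟨_, hM, _, aux_norm hO hM, ⟨fun _ => 1, by simp, by simp⟩, ![a, b, e, f, g], hs,
    ![(u 0)⁻¹, (u 1)⁻¹, (u 2)⁻¹, (u 3)⁻¹, 1], ?_, ?_⟩
  · intro k
    fin_cases k <;> simp [hu0]
  · have hc : ∀ k, (Matrix.diagonal (fun i => (u i)⁻¹) * N).mulVec (O (s k))
        = (u k)⁻¹ • Pi.single k 1 := by
      intro k
      rw [← Matrix.mulVec_mulVec, hNdef, aux_col hd]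
      ext j
      rw [Matrix.mulVec_diagonal]
      by_cases hj : j = k
      · subst hj; simp
      · simp [hj]
    have hl : (Matrix.diagonal (fun i => (u i)⁻¹) * N).mulVec (O g) = fun _ => 1 := by
      rw [← Matrix.mulVec_mulVec, ← hu]
      ext j
      rw [Matrix.mulVec_diagonal]
      exact inv_mul_cancel₀ (hu0 j)
    intro k
    fin_cases k
    · refine (hc 0).trans ?_
      ext j; fin_cases j <;> simp [stdFive]
    · refine (hc 1).trans ?_
      ext j; fin_cases j <;> simp [stdFive]
    · refine (hc 2).trans ?_
      ext j; fin_cases j <;> simp [stdFive]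
    · refine (hc 3).trans ?_
      ext j; fin_cases j <;> simp [stdFive]
    · refine hl.trans ?_
      ext j; fin_cases j <;> simp [stdFive]

theorem aux_move {T : Finset (Fin 8)} {a b e f : Fin 8}
    (hsurj : ∀ q : ℚ, ∃ x : F, v x = (q : WithTop ℚ))
    (hs : Function.Injective ![a, b, e, f])
    (ha : a ∈ T) (hb : b ∈ T) (he : e ∉ T) (hf : f ∉ T)
    (O : Octad F) (hO : Normalized v O) (h : HasPluck v O (vln T)) :
    ∃ O' : Octad F, Normalized v O' ∧ PGLMove O O' ∧ HasPluck v O' (vln Tᶜ) := by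
  obtain ⟨p, hp⟩ := hsurj 1
  obtain ⟨q, hq⟩ := hsurj (-1)
  have hp0 := aux_ne_zero hp
  have hq0 := aux_ne_zero hq
  have hpq : v (q * p) = 0 := by
    rw [v.map_mul, hp, hq, ← WithTop.coe_add]; norm_num
  have hd := aux_det h hs ha hb he hf
  have hB : IntegralMat v (aux_B O ![a, b, e, f]) := fun i j => (hO _).1 _
  have hN := aux_inv hB hd
  have hnorm := aux_norm hO hN
  have hT : ∀ i ∈ T, ∀ r : Fin 4, r = 2 ∨ r = 3 →
      1 ≤ v ((aux_B O ![a, b, e, f])⁻¹.mulVec (O i) r) := by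
    intro i hi r hr
    by_cases hia : i = a
    · have := aux_col hd 0
      simp only [Matrix.cons_val_zero] at this
      rw [hia, this]
      rcases hr with rfl | rfl <;> simp
    by_cases hib : i = b
    · have := aux_col hd 1
      simp only [Matrix.cons_val_one, Matrix.cons_val_zero] at this
      rw [hib, this]
      rcases hr with rfl | rfl <;> simp
    have hie : i ≠ e := fun h => he (h ▸ hi)
    have hif : i ≠ f := fun h => hf (h ▸ hi)
    have his : ∀ k, i ≠ ![a, b, e, f] k := by
      intro k; fin_cases k <;> simpa
    rw [aux_coord hd]
    refine (aux_pluck' h 1 _ ?_ ?_).ge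
    rotate_left
    · rcases hr with rfl | rfl <;>
        simp [ha, hb, he, hf, hi, Function.update] <;> norm_num
    · intro x y hxy
      simp only [Function.update_apply] at hxy
      split_ifs at hxy with h1 h2 h2
      · rw [h1, h2]
      · exact absurd hxy (his _)
      · exact absurd hxy.symm (his _)
      · exact hs hxy
  have hT' : ∀ i, i ∉ T → ∃ r : Fin 4, (r = 2 ∨ r = 3) ∧
      v ((aux_B O ![a, b, e, f])⁻¹.mulVec (O i) r) = 0 := by
    intro i hi
    by_cases hif : i = f
    · have := aux_col hd 3
      simp only [Matrix.cons_val] at this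
      refine ⟨3, Or.inr rfl, ?_⟩
      rw [hif, this]
      simp
    refine ⟨2, Or.inl rfl, ?_⟩
    by_cases hie : i = e
    · have := aux_col hd 2
      simp only [Matrix.cons_val] at this
      rw [hie, this]
      simp
    have hia : i ≠ a := fun h => hi (h ▸ ha)
    have hib : i ≠ b := fun h => hi (h ▸ hb)
    have his : ∀ k, i ≠ ![a, b, e, f] k := by
      intro k; fin_cases k <;> simpa
    rw [aux_coord hd]
    refine aux_pluck' h 0 _ ?_ ?_
    rotate_left
    · simp [ha, hb, he, hf, hi, Function.update] <;> norm_num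
    · intro x y hxy
      simp only [Function.update_apply] at hxy
      split_ifs at hxy with h1 h2 h2
      · rw [h1, h2]
      · exact absurd hxy (his _)
      · exact absurd hxy.symm (his _)
      · exact hs hxy
  have hNd : v (aux_B O ![a, b, e, f])⁻¹.det = 0 := by
    rw [Matrix.det_nonsing_inv, Ring.inverse_eq_inv', aux_v_inv hd]
  generalize (aux_B O ![a, b, e, f])⁻¹ = N at *
  have hMd : v (Matrix.diagonal ![p, p, 1, 1] * N).det = ((2 : ℚ) : WithTop ℚ) := by
    rw [Matrix.det_mul, v.map_mul, hNd, Matrix.det_diagonal, Fin.prod_univ_four]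
    simp only [Matrix.cons_val, mul_one, add_zero]
    rw [v.map_mul, hp, ← WithTop.coe_add]
    norm_num
  have hc0 : ∀ i, (if i ∈ T then q else 1) ≠ 0 := by
    intro i; split_ifs <;> simp [hq0]
  have hq1 : ∀ x : F, 1 ≤ v x → 0 ≤ v (q * x) := by
    intro x hx
    rw [v.map_mul, hq]
    calc (0 : WithTop ℚ) = ((-1 : ℚ) : WithTop ℚ) + ((1 : ℚ) : WithTop ℚ) := by
          rw [← WithTop.coe_add]; norm_num
      _ ≤ _ := by gcongr; exact hx
  have hent : ∀ i r, ((if i ∈ T then q else 1) •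
      (Matrix.diagonal ![p, p, 1, 1] * N).mulVec (O i)) r =
      (if i ∈ T then q else 1) * (![p, p, 1, 1] r * N.mulVec (O i) r) := by
    intro i r
    rw [← Matrix.mulVec_mulVec, Pi.smul_apply, smul_eq_mul, Matrix.mulVec_diagonal]
  refine ⟨fun i => (if i ∈ T then q else 1) • (Matrix.diagonal ![p, p, 1, 1] * N).mulVec (O i),
    ?_, ⟨_, isUnit_iff_ne_zero.2 (aux_ne_zero hMd), _, hc0, fun i => rfl⟩, ?_⟩
  · intro i
    simp only [hent]
    obtain ⟨hge, j0, hj0⟩ := hnorm i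
    simp only at hge hj0
    by_cases hi : i ∈ T
    · simp only [hi, if_true]
      have e0 : ∀ r : Fin 4, r = 0 ∨ r = 1 →
          v (q * (![p, p, 1, 1] r * N.mulVec (O i) r)) = v (N.mulVec (O i) r) := by
        rintro r (rfl | rfl) <;>
        · simp only [Matrix.cons_val]
          rw [← mul_assoc, v.map_mul, hpq, zero_add]
      have e2 : ∀ r : Fin 4, r = 2 ∨ r = 3 →
          0 ≤ v (q * (![p, p, 1, 1] r * N.mulVec (O i) r)) := by
        intro r hr
        apply hq1
        have := hT i hi r hr
        rcases hr with rfl | rfl <;> simpa only [Matrix.cons_val, one_mul] using this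
      have hr4 : ∀ r : Fin 4, (r = 0 ∨ r = 1) ∨ (r = 2 ∨ r = 3) := by decide
      constructor
      · intro r
        rcases hr4 r with hr | hr
        · rw [e0 r hr]; exact hge r
        · exact e2 r hr
      · refine ⟨j0, ?_⟩
        rcases hr4 j0 with hr | hr
        · rw [e0 _ hr, hj0]
        · have := hT i hi _ hr
          rw [hj0] at this
          have h' : (1 : ℚ) ≤ 0 := WithTop.coe_le_coe.1 this
          norm_num at h'
    · simp only [hi, if_false, one_mul]
      constructor
      · intro r
        refine aux_v_mul_nonneg ?_ (hge r)
        have h1 : (0 : WithTop ℚ) ≤ v p := by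
          rw [hp]; exact WithTop.coe_le_coe.2 zero_le_one
        fin_cases r <;> simp [h1]
      · obtain ⟨r, hr, hv⟩ := hT' i hi
        refine ⟨r, ?_⟩
        rcases hr with rfl | rfl <;> simpa only [Matrix.cons_val, one_mul] using hv
  · intro Q
    have hsub : subMat (fun i => (if i ∈ T then q else 1) •
        (Matrix.diagonal ![p, p, 1, 1] * N).mulVec (O i)) Q =
        (Matrix.diagonal ![p, p, 1, 1] * N) * subMat O Q *
          Matrix.diagonal (fun k => if Q.1.orderEmbOfFin Q.2 k ∈ T then q else 1) := by
      ext r c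
      rw [Matrix.mul_diagonal, mul_comm]
      simp only [subMat, Matrix.of_apply, Pi.smul_apply, smul_eq_mul]
      rfl
    have hprod : ∏ k, (if Q.1.orderEmbOfFin Q.2 k ∈ T then q else 1) = q ^ (Q.1 ∩ T).card := by
      have h1 : ∏ i ∈ Q.1, (if i ∈ T then q else 1) = q ^ (Q.1 ∩ T).card := by
        rw [Finset.prod_ite, Finset.prod_const, Finset.prod_const_one, mul_one,
          Finset.filter_mem_eq_inter]
      rw [← h1]
      conv_rhs => rw [← Finset.image_orderEmbOfFin_univ Q.1 Q.2]
      rw [Finset.prod_image (Q.1.orderEmbOfFin Q.2).injective.injOn]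
    have hqn : ∀ n : ℕ, v (q ^ n) = ((-(n : ℚ) : ℚ) : WithTop ℚ) := by
      intro n
      induction n with
      | zero => simp
      | succ n ih =>
        rw [pow_succ, v.map_mul, ih, hq, ← WithTop.coe_add]
        congr 1
        push_cast
        ring
    have hcard : ((Q.1 ∩ T).card : ℚ) + (Q.1 ∩ Tᶜ).card = 4 := by
      have := Finset.card_inter_add_card_sdiff Q.1 T
      rw [Finset.sdiff_eq_inter_compl, Q.2] at this
      exact_mod_cast this
    rw [hsub, Matrix.det_mul, Matrix.det_mul, Matrix.det_diagonal, hprod, v.map_mul, v.map_mul,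
      hMd, h Q, hqn, ← WithTop.coe_add, ← WithTop.coe_add]
    congr 1
    unfold vln
    rcases max_cases (((Q.1 ∩ T).card : ℚ) - 2) 0 with ⟨h1, h2⟩ | ⟨h1, h2⟩ <;>
    rcases max_cases (((Q.1 ∩ Tᶜ).card : ℚ) - 2) 0 with ⟨h3, h4⟩ | ⟨h3, h4⟩ <;>
    rw [h1, h3] <;> linarith

end Aux

/-- The valuation data `v_ln^{ABCD}` and `v_ln^{EFGH}` (the `Line` blocks)
are PGL-equivalent, and every octad with one of these Plücker valuation vectors is carried by
an element of `GL₄(O)` to an octad five of whose points are in standard position.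
(Labels: `A,…,H = 0,…,7`.) -/
theorem line_blocks_PGL_equivalent
    (F : Type) [Field F] [IsAlgClosed F] (v : AddValuation F (WithTop ℚ))
    (hsurj : ∀ q : ℚ, ∃ x : F, v x = (q : WithTop ℚ))
    (hres : v 2 = 0) :
    PGLequiv v (vln {0, 1, 2, 3}) (vln {4, 5, 6, 7}) ∧
    GLOStd v (vln {0, 1, 2, 3}) ∧ GLOStd v (vln {4, 5, 6, 7}) := by
  have h1 : ({0, 1, 2, 3} : Finset (Fin 8))ᶜ = {4, 5, 6, 7} := by decide
  have h2 : ({4, 5, 6, 7} : Finset (Fin 8))ᶜ = {0, 1, 2, 3} := by decide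
  refine ⟨⟨?_, ?_⟩, ?_, ?_⟩
  · rw [← h1]
    exact aux_move (a := 0) (b := 1) (e := 4) (f := 5) hsurj (by decide) (by decide) (by decide)
      (by decide) (by decide)
  · rw [← h2]
    exact aux_move (a := 4) (b := 5) (e := 0) (f := 1) hsurj (by decide) (by decide) (by decide)
      (by decide) (by decide)
  · exact aux_GLOStd (a := 0) (b := 1) (e := 4) (f := 5) (g := 6) (by decide) (by decide)
      (by decide) (by decide) (by decide) (by decide)
  · exact aux_GLOStd (a := 4) (b := 5) (e := 0) (f := 1) (g := 2) (by decide) (by decide)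
      (by decide) (by decide) (by decide) (by decide)

end
end
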